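/- arXiv:1410.4109 — 3 statements merged into one kernel-verified Lean document; each statement's English description precedes it below -/
import Mathlib

section
/- Let n ≥ 3 and let i, j be integers with 3 ≤ i ≤ n, 2 ≤ j < i. Then g_n(1ij) = q^{i-j} · g_{n-1}(1j) in ℤ[q]. -/
open Finset Polynomial

/-- The cycle of `π` starting at `m`: `m, π m, π² m, …` through one full period. -/
noncomputable def cycleList {n : ℕ} (π : Equiv.Perm (Fin n)) (m : Fin n) : List (Fin n) :=
  (List.range (Function.minimalPeriod π m)).map (fun k => (π ^ k) m)

/-- The minima of the cycles of `π`, listed in increasing order. -/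
def cycleMins {n : ℕ} (π : Equiv.Perm (Fin n)) : List (Fin n) :=
  (Finset.univ.filter (fun m : Fin n => ∀ k < n, m ≤ (π ^ k) m)).sort (· ≤ ·)

/-- The flattened permutation of `π`, as a word on the letters `1, …, n`:
erase the parentheses from the standard cycle form of `π`. -/
noncomputable def flattenPerm {n : ℕ} (π : Equiv.Perm (Fin n)) : List ℕ :=
  ((cycleMins π).map (cycleList π)).flatten.map (fun m => (m : ℕ) + 1)

/-- The number of occurrences of the pattern 13-2 in the word `w = w₁w₂⋯wₙ`
(1-based), i.e. the number of pairs `(i,j)` with `2 ≤ i < j ≤ n` and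
`w_{i-1} < w_j < w_i`.  Below, `p.1` and `p.2` are the 0-based versions of `i` and `j`. -/
def occ (w : List ℕ) : ℕ :=
  ((Finset.range w.length ×ˢ Finset.range w.length).filter
    (fun p : ℕ × ℕ => 1 ≤ p.1 ∧ p.1 < p.2 ∧
      w.getD (p.1 - 1) 0 < w.getD p.2 0 ∧ w.getD p.2 0 < w.getD p.1 0)).card

/-- `g_n = Σ_{π ∈ S_n} q^{occ(Flatten(π))} ∈ ℤ[q]`. -/
noncomputable def gPoly (n : ℕ) : Polynomial ℤ :=
  ∑ π : Equiv.Perm (Fin n), X ^ occ (flattenPerm π)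

/-- `g_n(a₁⋯a_k)`: the sum of `q^{occ(Flatten(π))}` over the permutations `π` of length `n`
whose flattened permutation starts with the subword `a₁⋯a_k`. -/
noncomputable def gPrefix (n : ℕ) (w : List ℕ) : Polynomial ℤ :=
  ∑ π ∈ Finset.univ.filter (fun π : Equiv.Perm (Fin n) => w <+: flattenPerm π),
    X ^ occ (flattenPerm π)

/-- `g_{n,r}(a₁⋯a_k)`: the number of permutations `π` of length `n` such that `Flatten(π)`
starts with `a₁⋯a_k` and has exactly `r` occurrences of the pattern 13-2. -/
noncomputable def gCount (n r : ℕ) (w : List ℕ) : ℕ :=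
  (Finset.univ.filter (fun π : Equiv.Perm (Fin n) =>
    w <+: flattenPerm π ∧ occ (flattenPerm π) = r)).card


namespace Flat

lemma mem_cycleList {n : ℕ} (π : Equiv.Perm (Fin n)) (m x : Fin n) :
    x ∈ cycleList π m ↔ π.SameCycle m x := by
  unfold cycleList
  simp only [List.mem_map, List.mem_range]
  constructor
  · rintro ⟨k, -, rfl⟩
    exact ⟨k, by simp⟩
  · intro h
    obtain ⟨k, hk⟩ := h.exists_nat_pow_eq
    have hp : 0 < Function.minimalPeriod π m :=
      Function.minimalPeriod_pos_of_mem_periodicPts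
        (Function.Injective.mem_periodicPts π.injective m)
    refine ⟨k % Function.minimalPeriod π m, Nat.mod_lt _ hp, ?_⟩
    rw [← hk, Equiv.Perm.coe_pow, Equiv.Perm.coe_pow, Function.iterate_mod_minimalPeriod_eq]

lemma minimalPeriod_pos {n : ℕ} (π : Equiv.Perm (Fin n)) (m : Fin n) :
    0 < Function.minimalPeriod π m :=
  Function.minimalPeriod_pos_of_mem_periodicPts
    (Function.Injective.mem_periodicPts π.injective m)

lemma minimalPeriod_le {n : ℕ} (π : Equiv.Perm (Fin n)) (m : Fin n) :
    Function.minimalPeriod π m ≤ n := by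
  have h : ((Finset.range (Function.minimalPeriod π m)).image (fun k => (π ^ k) m)).card
      ≤ (Finset.univ : Finset (Fin n)).card := Finset.card_le_card (Finset.subset_univ _)
  rw [Finset.card_image_of_injOn] at h
  · simpa using h
  · intro a ha b hb hab
    simp only [Equiv.Perm.coe_pow] at hab
    exact Function.iterate_injOn_Iio_minimalPeriod (by simpa using ha) (by simpa using hb) hab

lemma mem_cycleMins {n : ℕ} (π : Equiv.Perm (Fin n)) (m : Fin n) :
    m ∈ cycleMins π ↔ ∀ y, π.SameCycle m y → m ≤ y := by
  unfold cycleMins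
  simp only [Finset.mem_sort, Finset.mem_filter, Finset.mem_univ, true_and]
  constructor
  · intro h y hy
    rw [← mem_cycleList] at hy
    simp only [cycleList, List.mem_map, List.mem_range] at hy
    obtain ⟨k, hk, rfl⟩ := hy
    exact h k (hk.trans_le (minimalPeriod_le π m))
  · intro h k _
    exact h _ ⟨k, by simp⟩

lemma nodup_cycleList {n : ℕ} (π : Equiv.Perm (Fin n)) (m : Fin n) :
    (cycleList π m).Nodup := by
  unfold cycleList
  refine List.Nodup.map_on ?_ List.nodup_range
  intro a ha b hb hab
  simp only [Equiv.Perm.coe_pow] at hab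
  exact Function.iterate_injOn_Iio_minimalPeriod (by simpa using ha) (by simpa using hb) hab

lemma nodup_cycleMins {n : ℕ} (π : Equiv.Perm (Fin n)) : (cycleMins π).Nodup := by
  unfold cycleMins; exact Finset.sort_nodup _ _

/-- flattened permutation as a word on `Fin n` -/
noncomputable def flat {n : ℕ} (π : Equiv.Perm (Fin n)) : List (Fin n) :=
  ((cycleMins π).map (cycleList π)).flatten

lemma nodup_flat {n : ℕ} (π : Equiv.Perm (Fin n)) : (flat π).Nodup := by
  unfold flat
  rw [List.nodup_flatten]
  constructor
  · intro l hl
    obtain ⟨m, -, rfl⟩ := List.mem_map.1 hl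
    exact nodup_cycleList π m
  · rw [List.pairwise_map]
    refine (nodup_cycleMins π).imp_of_mem ?_
    intro a b ha hb hab x hx hy
    rw [mem_cycleList] at hx hy
    rw [mem_cycleMins] at ha hb
    exact hab (le_antisymm (ha _ (hx.trans hy.symm)) (hb _ (hy.trans hx.symm)))

lemma mem_flat {n : ℕ} (π : Equiv.Perm (Fin n)) (x : Fin n) : x ∈ flat π := by
  classical
  unfold flat
  have hne : (Finset.univ.filter (fun y => π.SameCycle x y)).Nonempty :=
    ⟨x, by simp [Equiv.Perm.SameCycle.refl]⟩
  have h1 := Finset.min'_mem _ hne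
  simp only [Finset.mem_filter, Finset.mem_univ, true_and] at h1
  simp only [List.mem_flatten, List.mem_map, exists_exists_and_eq_and]
  refine ⟨_, ?_, (mem_cycleList π _ x).2 h1.symm⟩
  rw [mem_cycleMins]
  intro y hy
  exact Finset.min'_le _ _ (by simpa using h1.trans hy)

lemma cycleList_cons {n : ℕ} (π : Equiv.Perm (Fin n)) (m : Fin n) :
    cycleList π m = m :: (List.range (Function.minimalPeriod π m - 1)).map
      (fun k => (π ^ (k + 1)) m) := by
  obtain ⟨p, hp⟩ := Nat.exists_eq_succ_of_ne_zero (minimalPeriod_pos π m).ne'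
  unfold cycleList
  rw [hp, Nat.succ_eq_add_one, List.range_succ_eq_map]
  simp [Function.comp_def]

lemma cycleMins_cons {k : ℕ} (π : Equiv.Perm (Fin (k+1))) :
    ∃ M, cycleMins π = 0 :: M := by
  have h0 : (0 : Fin (k+1)) ∈ cycleMins π := (mem_cycleMins π 0).2 (fun _ _ => Fin.zero_le _)
  have hs : (cycleMins π).Pairwise (· ≤ ·) := by
    unfold cycleMins; exact Finset.pairwise_sort _ _
  cases h : cycleMins π with
  | nil => simp [h] at h0
  | cons a M =>
    rw [h] at h0 hs
    rcases List.mem_cons.1 h0 with h1 | h1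
    · exact ⟨M, by rw [← h1]⟩
    · have := (List.pairwise_cons.1 hs).1 _ h1
      exact ⟨M, by rw [Fin.le_zero_iff.1 this]⟩

/-- insert `I` after `0` in its cycle. -/
def ins {k : ℕ} (I : Fin (k+2)) (σ : Equiv.Perm (Fin (k+1))) : Equiv.Perm (Fin (k+2)) :=
  (finSuccEquiv' I).symm.permCongr (Equiv.optionCongr σ) * Equiv.swap 0 I

variable {k : ℕ} {I : Fin (k+2)} (hI : I ≠ 0) (σ : Equiv.Perm (Fin (k+1)))

lemma ins_zero : ins I σ 0 = I := by
  simp [ins, Equiv.permCongr_apply]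

lemma sA_zero (hI : I ≠ 0) : I.succAbove 0 = 0 := Fin.succAbove_ne_zero_zero hI

lemma ins_I (hI : I ≠ 0) : ins I σ I = I.succAbove (σ 0) := by
  have : finSuccEquiv' I 0 = some 0 := by
    rw [← sA_zero hI, finSuccEquiv'_succAbove]
  simp [ins, Equiv.permCongr_apply, this]

lemma ins_succAbove (hI : I ≠ 0) (x : Fin (k+1)) (hx : x ≠ 0) :
    ins I σ (I.succAbove x) = I.succAbove (σ x) := by
  have h1 : I.succAbove x ≠ 0 := by
    rw [← sA_zero hI]; exact fun h => hx (Fin.succAbove_right_injective h)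
  simp [ins, Equiv.permCongr_apply, Equiv.swap_apply_of_ne_of_ne h1 (Fin.succAbove_ne I x)]

lemma ins_injective (hI : I ≠ 0) : Function.Injective (ins I : _ → Equiv.Perm (Fin (k+2))) := by
  intro σ τ h
  ext x : 1
  apply Fin.succAbove_right_injective (p := I)
  by_cases hx : x = 0
  · subst hx; rw [← ins_I σ hI, ← ins_I τ hI, h]
  · rw [← ins_succAbove σ hI x hx, ← ins_succAbove τ hI x hx, h]

lemma ins_surj (π : Equiv.Perm (Fin (k+2))) (h : π 0 = I) : ∃ σ, ins I σ = π := by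
  have hn : (((finSuccEquiv' I).permCongr) (π * Equiv.swap 0 I)) none = none := by
    simp [Equiv.permCongr_apply, h]
  refine ⟨Equiv.removeNone (((finSuccEquiv' I).permCongr) (π * Equiv.swap 0 I)), ?_⟩
  unfold ins
  have key : Equiv.optionCongr (Equiv.removeNone
      (((finSuccEquiv' I).permCongr) (π * Equiv.swap 0 I))) =
      ((finSuccEquiv' I).permCongr) (π * Equiv.swap 0 I) := by
    rw [map_equiv_removeNone, hn, Equiv.swap_self]; rfl
  rw [key]
  ext x : 1
  simp [Equiv.permCongr_apply]

lemma not_same_pow (x : Fin (k+1)) (hx : ¬ σ.SameCycle 0 x) (hI : I ≠ 0) (t : ℕ) :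
    (ins I σ ^ t) (I.succAbove x) = I.succAbove ((σ ^ t) x) := by
  induction t with
  | zero => simp
  | succ t ih =>
    rw [pow_succ', Equiv.Perm.mul_apply, ih, pow_succ', Equiv.Perm.mul_apply]
    apply ins_succAbove _ hI
    intro h
    exact hx (Equiv.Perm.SameCycle.symm ⟨t, by simpa using h⟩)

lemma cycleList_not_same (x : Fin (k+1)) (hx : ¬ σ.SameCycle 0 x) (hI : I ≠ 0) :
    cycleList (ins I σ) (I.succAbove x) = (cycleList σ x).map I.succAbove := by
  have hp : Function.minimalPeriod (ins I σ) (I.succAbove x) = Function.minimalPeriod σ x := by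
    rw [Function.minimalPeriod_eq_minimalPeriod_iff]
    intro t
    unfold Function.IsPeriodicPt Function.IsFixedPt
    rw [← Equiv.Perm.coe_pow, ← Equiv.Perm.coe_pow, not_same_pow σ x hx hI]
    exact Fin.succAbove_right_injective.eq_iff
  unfold cycleList
  rw [hp, List.map_map]
  apply List.map_congr_left
  intro t _
  exact not_same_pow σ x hx hI t

lemma same_pow (hI : I ≠ 0) (t : ℕ) (ht : t + 1 ≤ Function.minimalPeriod σ 0) :
    (ins I σ ^ (t+2)) 0 = I.succAbove ((σ ^ (t+1)) 0) := by
  induction t with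
  | zero =>
    rw [pow_succ, Equiv.Perm.mul_apply, ins_zero]
    simp [ins_I σ hI]
  | succ t ih =>
    rw [show t + 1 + 2 = (t+2)+1 by ring, pow_succ', Equiv.Perm.mul_apply, ih (by omega),
      pow_succ' _ (t+1), Equiv.Perm.mul_apply]
    apply ins_succAbove _ hI
    intro h
    have h2 : Function.IsPeriodicPt σ (t+1) 0 := by
      unfold Function.IsPeriodicPt Function.IsFixedPt
      rw [← Equiv.Perm.coe_pow]; exact h
    have := h2.minimalPeriod_le (by omega)
    omega

lemma period_zero (hI : I ≠ 0) :
    Function.minimalPeriod (ins I σ) 0 = Function.minimalPeriod σ 0 + 1 := by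
  have hpos := minimalPeriod_pos σ 0
  apply le_antisymm
  · apply Function.IsPeriodicPt.minimalPeriod_le (by omega)
    unfold Function.IsPeriodicPt Function.IsFixedPt
    rw [← Equiv.Perm.coe_pow]
    have := same_pow σ hI (Function.minimalPeriod σ 0 - 1) (by omega)
    rw [show Function.minimalPeriod σ 0 - 1 + 2 = Function.minimalPeriod σ 0 + 1 by omega,
      show Function.minimalPeriod σ 0 - 1 + 1 = Function.minimalPeriod σ 0 by omega] at this
    rw [this, Equiv.Perm.coe_pow, Function.iterate_minimalPeriod, sA_zero hI]
  · by_contra hlt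
    have hq := minimalPeriod_pos (ins I σ) 0
    have hper := Function.isPeriodicPt_minimalPeriod (ins I σ) 0
    set q := Function.minimalPeriod (ins I σ) 0
    unfold Function.IsPeriodicPt Function.IsFixedPt at hper
    rw [← Equiv.Perm.coe_pow] at hper
    rcases q with _ | _ | t
    · omega
    · simp [ins_zero, hI] at hper
    · rw [same_pow σ hI t (by omega)] at hper
      have h2 : Function.IsPeriodicPt σ (t+1) 0 := by
        unfold Function.IsPeriodicPt Function.IsFixedPt
        rw [← Equiv.Perm.coe_pow]
        apply Fin.succAbove_right_injective (p := I)
        rw [hper, sA_zero hI]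
      have := h2.minimalPeriod_le (by omega)
      omega

lemma cycleList_zero (hI : I ≠ 0) :
    cycleList (ins I σ) 0 = 0 :: I :: (cycleList σ 0).tail.map I.succAbove := by
  rw [cycleList_cons, cycleList_cons σ, period_zero σ hI]
  obtain ⟨p, hp⟩ := Nat.exists_eq_succ_of_ne_zero (minimalPeriod_pos σ 0).ne'
  rw [hp]
  simp only [Nat.succ_eq_add_one, Nat.add_sub_cancel, List.range_succ_eq_map, List.map_cons,
    List.map_map, List.tail_cons, zero_add, pow_one, ins_zero]
  congr 2
  apply List.map_congr_left
  intro t ht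
  have := List.mem_range.1 ht
  exact same_pow σ hI t (by omega)

lemma mem_mins_ins (hI : I ≠ 0) (y : Fin (k+2)) :
    y ∈ cycleMins (ins I σ) ↔ ∃ x ∈ cycleMins σ, I.succAbove x = y := by
  have hI0 : (ins I σ).SameCycle 0 I := ⟨1, by simp [ins_zero]⟩
  rcases Fin.eq_self_or_eq_succAbove I y with rfl | ⟨x, rfl⟩
  · constructor
    · intro h
      rw [mem_cycleMins] at h
      exact absurd (Fin.le_zero_iff.1 (h 0 hI0.symm)) hI
    · rintro ⟨x, -, h⟩
      exact absurd h (Fin.succAbove_ne _ _)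
  · have : (∃ z ∈ cycleMins σ, I.succAbove z = I.succAbove x) ↔ x ∈ cycleMins σ := by
      constructor
      · rintro ⟨z, hz, h⟩
        rwa [← Fin.succAbove_right_injective h]
      · intro h; exact ⟨x, h, rfl⟩
    rw [this]
    by_cases hx : σ.SameCycle 0 x
    · by_cases hx0 : x = 0
      · subst hx0
        rw [sA_zero hI, mem_cycleMins, mem_cycleMins]
        exact ⟨fun _ _ _ => Fin.zero_le _, fun _ _ _ => Fin.zero_le _⟩
      · have h1 : x ∉ cycleMins σ := by
          rw [mem_cycleMins]; intro h
          exact hx0 (Fin.le_zero_iff.1 (h 0 hx.symm))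
        have h2 : (ins I σ).SameCycle 0 (I.succAbove x) := by
          rw [← mem_cycleList, cycleList_zero σ hI]
          rw [← mem_cycleList, cycleList_cons] at hx
          rw [cycleList_cons σ]
          rcases List.mem_cons.1 hx with h | h
          · exact absurd h hx0
          · exact List.mem_cons_of_mem _ (List.mem_cons_of_mem _ (List.mem_map_of_mem h))
        refine iff_of_false ?_ h1
        rw [mem_cycleMins]; intro h
        have := Fin.le_zero_iff.1 (h 0 h2.symm)
        rw [← sA_zero hI] at this
        exact hx0 (Fin.succAbove_right_injective this)
    · rw [mem_cycleMins, mem_cycleMins]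
      simp_rw [← mem_cycleList, cycleList_not_same σ x hx hI]
      simp [Fin.succAbove_le_succAbove_iff]

lemma cycleMins_ins (hI : I ≠ 0) :
    cycleMins (ins I σ) = (cycleMins σ).map I.succAbove := by
  apply List.Perm.eq_of_pairwise' (r := (· ≤ ·))
  · unfold cycleMins; exact Finset.pairwise_sort _ _
  · rw [List.pairwise_map]
    simp only [Fin.succAbove_le_succAbove_iff]
    unfold cycleMins; exact Finset.pairwise_sort _ _
  · rw [List.perm_ext_iff_of_nodup (nodup_cycleMins _)
      ((nodup_cycleMins σ).map Fin.succAbove_right_injective)]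
    intro y
    rw [mem_mins_ins σ hI, List.mem_map]

lemma flat_ins (hI : I ≠ 0) :
    ∃ T, flat σ = 0 :: T ∧ flat (ins I σ) = 0 :: I :: T.map I.succAbove := by
  obtain ⟨M, hM⟩ := cycleMins_cons σ
  have hM2 := cycleMins_ins σ hI
  refine ⟨(cycleList σ 0).tail ++ (M.map (cycleList σ)).flatten, ?_, ?_⟩
  · unfold flat
    rw [hM, List.map_cons, List.flatten_cons]
    conv_lhs => rw [cycleList_cons]
    rw [cycleList_cons σ]; rfl
  · unfold flat
    rw [hM2, hM, List.map_cons, List.map_cons, List.flatten_cons, sA_zero hI,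
      cycleList_zero σ hI, List.map_append, List.map_flatten, List.map_map, List.map_map]
    simp only [List.cons_append]
    congr 4
    apply List.map_congr_left
    intro x hx
    apply cycleList_not_same σ x _ hI
    intro h
    have hnd := nodup_cycleMins σ
    have hx' : x ∈ cycleMins σ := by rw [hM]; exact List.mem_cons_of_mem _ hx
    rw [mem_cycleMins] at hx'
    have := Fin.le_zero_iff.1 (hx' 0 h.symm)
    subst this
    rw [hM] at hnd
    exact (List.nodup_cons.1 hnd).1 hx

lemma apply_zero_of_flat (π : Equiv.Perm (Fin (k+2))) (T) (h : flat π = 0 :: I :: T)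
    (hI : 2 ≤ (I : ℕ)) : π 0 = I := by
  obtain ⟨M, hM⟩ := cycleMins_cons π
  unfold flat at h
  rw [hM, List.map_cons, List.flatten_cons, cycleList_cons] at h
  obtain ⟨p, hp⟩ := Nat.exists_eq_succ_of_ne_zero (minimalPeriod_pos π 0).ne'
  rw [hp, Nat.succ_eq_add_one, Nat.add_sub_cancel] at h
  rcases p with _ | p
  · exfalso
    have hfix : π 0 = 0 := Function.minimalPeriod_eq_one_iff_isFixedPt.1 hp
    have h1 : (1 : Fin (k+2)) ∈ cycleMins π := by
      rw [mem_cycleMins]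
      intro y hy
      by_contra hlt
      have : y = 0 := by
        have := not_le.1 hlt
        rw [Fin.lt_def] at this
        ext
        simp at this
        simp [this]
      subst this
      have := hy.symm.eq_of_left hfix
      simp at this
    have hs : (cycleMins π).Pairwise (· ≤ ·) := by
      unfold cycleMins; exact Finset.pairwise_sort _ _
    rw [hM] at h1 hs
    have h1 : (1 : Fin (k+2)) ∈ M := by simpa using h1
    rcases M with _ | ⟨a, M⟩
    · simp at h1
    · rw [List.map_cons, List.flatten_cons, cycleList_cons] at h
      simp at h
      have ha : a = I := h.1
      have : a ≤ 1 := by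
        rcases List.mem_cons.1 h1 with h' | h'
        · exact h'.ge
        · exact (List.pairwise_cons.1 (List.pairwise_cons.1 hs).2).1 _ h'
      rw [ha, Fin.le_def] at this
      simp at this
      omega
  · rw [List.range_succ_eq_map] at h
    simp at h
    exact h.1

end Flat

namespace Flat

lemma occ_cons_cons (a b : ℕ) (w : List ℕ) :
    occ (a :: b :: w) = w.countP (fun x => a < x ∧ x < b) + occ (b :: w) := by
  have key : ∀ w : List ℕ, occ w = ∑ s ∈ Finset.range w.length, ∑ t ∈ Finset.range w.length,
      if (1 ≤ s ∧ s < t ∧ w.getD (s - 1) 0 < w.getD t 0 ∧ w.getD t 0 < w.getD s 0)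
        then 1 else 0 := by
    intro w
    unfold occ
    rw [Finset.card_filter, Finset.sum_product]
  have cnt : ∀ w : List ℕ, w.countP (fun x => a < x ∧ x < b) =
      ∑ t ∈ Finset.range w.length, if (a < w.getD t 0 ∧ w.getD t 0 < b) then 1 else 0 := by
    intro w
    induction w with
    | nil => simp
    | cons c w ih =>
      rw [List.countP_cons, ih, List.length_cons, Finset.sum_range_succ']
      simp
  rw [key, key, cnt]
  simp only [List.length_cons]
  rw [Finset.sum_range_succ', Finset.sum_range_succ' _ w.length]
  rw [Finset.sum_range_succ' _ w.length]
  have e1 : ∀ s, (∑ t ∈ Finset.range (w.length + 1 + 1),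
      if (1 ≤ s + 1 + 1 ∧ s + 1 + 1 < t ∧ (a :: b :: w).getD (s + 1 + 1 - 1) 0 <
        (a :: b :: w).getD t 0 ∧ (a :: b :: w).getD t 0 < (a :: b :: w).getD (s + 1 + 1) 0)
        then 1 else 0) = ∑ t ∈ Finset.range (w.length + 1),
      if (1 ≤ s + 1 ∧ s + 1 < t ∧ (b :: w).getD (s + 1 - 1) 0 <
        (b :: w).getD t 0 ∧ (b :: w).getD t 0 < (b :: w).getD (s + 1) 0)
        then 1 else 0 := by
    intro s
    rw [Finset.sum_range_succ']
    simp
  simp_rw [e1]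
  have e2 : (∑ t ∈ Finset.range (w.length + 1 + 1),
      if (1 ≤ 0 + 1 ∧ 0 + 1 < t ∧ (a :: b :: w).getD (0 + 1 - 1) 0 <
        (a :: b :: w).getD t 0 ∧ (a :: b :: w).getD t 0 < (a :: b :: w).getD (0 + 1) 0)
        then 1 else 0) = ∑ t ∈ Finset.range w.length,
        if (a < w.getD t 0 ∧ w.getD t 0 < b) then 1 else 0 := by
    rw [Finset.sum_range_succ', Finset.sum_range_succ']
    simp
  rw [e2]
  simp
  ring

lemma occ_map {α : Type*} [LinearOrder α] (f g : α → ℕ) (hf : StrictMono f) (hg : StrictMono g)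
    (L : List α) : occ (L.map f) = occ (L.map g) := by
  induction L with
  | nil => rfl
  | cons a L ih =>
    cases L with
    | nil => simp [occ, Finset.filter_singleton]
    | cons b L =>
      simp only [List.map_cons] at ih ⊢
      rw [occ_cons_cons, occ_cons_cons, ih, List.countP_map, List.countP_map]
      simp [Function.comp_def, hf.lt_iff_lt, hg.lt_iff_lt]

lemma card_fin (N c : ℕ) (h1 : 1 ≤ c) (hc : c ≤ N) :
    (Finset.univ.filter (fun x : Fin N => 0 < (x : ℕ) ∧ (x : ℕ) < c)).card = c - 1 := by
  rw [Finset.card_filter, Fin.sum_univ_eq_sum_range (fun x => if 0 < x ∧ x < c then 1 else 0) N,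
    ← Finset.card_filter]
  have : (Finset.range N).filter (fun x => 0 < x ∧ x < c) = Finset.Ioo 0 c := by
    ext x; simp; omega
  rw [this]; simp

lemma countP_eq {N : ℕ} (L : List (Fin N)) (hL : L.Nodup) (hm : ∀ x, x ∈ L) (p : Fin N → Prop)
    [DecidablePred p] : L.countP (fun x => p x) = (Finset.univ.filter p).card := by
  have : Finset.univ.filter p = (L.filter (fun x => p x)).toFinset := by
    ext x; simp [hm]
  rw [this, List.toFinset_card_of_nodup (hL.filter _), List.countP_eq_length_filter]

lemma occ_main {k : ℕ} (I : Fin (k+2)) (J : Fin (k+1)) (hJ : 1 ≤ (J : ℕ)) (hJI : (J : ℕ) < I)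
    (T : List (Fin (k+1))) (hnd : (0 :: J :: T).Nodup) (hm : ∀ x, x ∈ 0 :: J :: T) :
    occ ((0 :: I :: (J :: T).map I.succAbove).map (fun m : Fin (k+2) => (m : ℕ) + 1)) =
      (I - J) + occ ((0 :: J :: T).map (fun m : Fin (k+1) => (m : ℕ) + 1)) := by
  have hI0 : I ≠ 0 := by rintro rfl; simp at hJI
  have hv : ∀ x : Fin (k+1), ((I.succAbove x : Fin (k+2)) : ℕ) = if (x : ℕ) < I then (x : ℕ) else x + 1 := by
    intro x
    simp only [Fin.succAbove, Fin.lt_def, Fin.val_castSucc]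
    split_ifs <;> simp
  have c1 := countP_eq _ hnd hm (fun x => 0 < (x : ℕ) ∧ (x : ℕ) < I)
  have c2 := countP_eq _ hnd hm (fun x => 0 < (x : ℕ) ∧ (x : ℕ) < J)
  rw [card_fin _ _ (by omega) (by omega)] at c1 c2
  have hmono := occ_map (fun x : Fin (k+1) => ((I.succAbove x : Fin (k+2)) : ℕ) + 1)
    (fun x => (x : ℕ) + 1) (fun x y h => by have := Fin.strictMono_succAbove I h; simpa using this)
    (fun x y h => by simpa using h) (J :: T)
  have z : ((T.map I.succAbove).map (fun m : Fin (k+2) => (m : ℕ) + 1)).countP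
     (fun x => (I : ℕ) + 1 < x ∧ x < ((I.succAbove J : Fin (k+2)) : ℕ) + 1) = 0 := by
    rw [List.countP_eq_zero]
    intro x _
    rw [hv, if_pos hJI]
    simp; omega
  simp only [List.map_cons, List.map_map] at z hmono ⊢
  rw [occ_cons_cons, occ_cons_cons, occ_cons_cons, z]
  simp only [Function.comp_def] at hmono ⊢
  rw [hmono]
  rw [List.countP_cons, List.countP_map, List.countP_map]
  simp only [Function.comp_def]
  have q1 : ∀ x : Fin (k+1), ((((0 : Fin (k+2)) : ℕ) + 1 < ((I.succAbove x : Fin (k+2)) : ℕ) + 1 ∧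
      ((I.succAbove x : Fin (k+2)) : ℕ) + 1 < (I : ℕ) + 1)) ↔ (0 < (x : ℕ) ∧ (x : ℕ) < I) := by
    intro x
    rw [hv, Fin.val_zero]
    split_ifs <;> omega
  have q2 : ∀ x : Fin (k+1), ((((0 : Fin (k+1)) : ℕ) + 1 < (x : ℕ) + 1 ∧
      (x : ℕ) + 1 < (J : ℕ) + 1)) ↔ (0 < (x : ℕ) ∧ (x : ℕ) < J) := by
    intro x
    rw [Fin.val_zero]
    omega
  simp only [q1, q2]
  rw [List.countP_cons, List.countP_cons] at c1 c2
  simp only [decide_eq_true_eq, Fin.val_zero, lt_irrefl, false_and, and_false, if_false] at c1 c2 ⊢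
  simp only [hJI, and_true] at c1 ⊢
  omega

lemma flattenPerm_eq {n : ℕ} (π : Equiv.Perm (Fin n)) :
    flattenPerm π = (flat π).map (fun m : Fin n => (m : ℕ) + 1) := by
  unfold flattenPerm flat
  simp [← List.map_eq_flatMap, Function.comp_def]

end Flat

/-- For `n ≥ 3`, `3 ≤ i ≤ n`, `2 ≤ j < i`,
`g_n(1ij) = q^{i-j}·g_{n-1}(1j)` in `ℤ[q]`. -/
theorem gPrefix_three_letters_lt (n i j : ℕ) (hn : 3 ≤ n) (hi : 3 ≤ i) (hin : i ≤ n)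
    (hj : 2 ≤ j) (hji : j < i) :
    gPrefix n [1, i, j] = X ^ (i - j) * gPrefix (n - 1) [1, j] := by
  obtain ⟨k, rfl⟩ : ∃ k, n = k + 2 := ⟨n - 2, by omega⟩
  obtain ⟨a, rfl⟩ : ∃ a, i = a + 1 := ⟨i - 1, by omega⟩
  obtain ⟨b, rfl⟩ : ∃ b, j = b + 1 := ⟨j - 1, by omega⟩
  change gPrefix (k+2) _ = _ * gPrefix (k+1) _
  let I : Fin (k+2) := ⟨a, by omega⟩
  let J : Fin (k+1) := ⟨b, by omega⟩
  have hI : I ≠ 0 := by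
    intro h; have := congrArg Fin.val h; simp [I] at this; omega
  have hIJ : I.succAbove J = ⟨b, by omega⟩ := by
    rw [Fin.succAbove_of_castSucc_lt]
    · rfl
    · simp [Fin.lt_def, I, J]; omega
  unfold gPrefix
  rw [Finset.mul_sum]
  symm
  have pre : ∀ σ : Equiv.Perm (Fin (k+1)), [1, b+1] <+: flattenPerm σ →
      ∃ T, Flat.flat σ = 0 :: J :: T ∧
        Flat.flat (Flat.ins I σ) = 0 :: I :: (J :: T).map I.succAbove := by
    intro σ h
    obtain ⟨T, h1, h2⟩ := Flat.flat_ins σ hI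
    rw [Flat.flattenPerm_eq, h1] at h
    cases T with
    | nil => simp [List.cons_prefix_cons] at h
    | cons x T =>
      have hx : x = J := by
        simp [List.cons_prefix_cons] at h
        ext; simp [J, h]
      subst hx
      exact ⟨T, h1, h2⟩
  refine Finset.sum_bij (fun σ _ => Flat.ins I σ) ?_ ?_ ?_ ?_
  · intro σ hσ
    simp only [Finset.mem_filter, Finset.mem_univ, true_and] at hσ ⊢
    obtain ⟨T, h1, h2⟩ := pre σ hσ
    rw [Flat.flattenPerm_eq, h2]
    simp [List.cons_prefix_cons, hIJ, I]
  · intro σ _ τ _ h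
    exact Flat.ins_injective hI h
  · intro π hπ
    simp only [Finset.mem_filter, Finset.mem_univ, true_and] at hπ
    rw [Flat.flattenPerm_eq] at hπ
    have hπ0 : π 0 = I := by
      rcases h : Flat.flat π with _ | ⟨x, _ | ⟨y, T⟩⟩
      · simp [h] at hπ
      · simp [h, List.cons_prefix_cons] at hπ
      · simp only [h, List.map_cons, List.cons_prefix_cons] at hπ
        have hx : x = 0 := Fin.ext (by rw [Fin.val_zero]; omega)
        have hy : y = I := by ext; simp [I]; omega
        subst hx hy
        exact Flat.apply_zero_of_flat π T h (by simp [I]; omega)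
    obtain ⟨σ, rfl⟩ := Flat.ins_surj π hπ0
    refine ⟨σ, ?_, rfl⟩
    simp only [Finset.mem_filter, Finset.mem_univ, true_and]
    obtain ⟨T, h1, h2⟩ := Flat.flat_ins σ hI
    rw [Flat.flattenPerm_eq, h1]
    rw [h2] at hπ
    cases T with
    | nil => simp [List.cons_prefix_cons] at hπ
    | cons x T =>
      simp only [List.map_cons, List.cons_prefix_cons] at hπ
      have hx : x = J := by
        apply Fin.succAbove_right_injective (p := I)
        rw [hIJ]; ext; simp; omega
      subst hx
      simp [List.cons_prefix_cons, J]
  · intro σ hσ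
    simp only [Finset.mem_filter, Finset.mem_univ, true_and] at hσ
    obtain ⟨T, h1, h2⟩ := pre σ hσ
    rw [Flat.flattenPerm_eq, Flat.flattenPerm_eq, h1, h2,
      Flat.occ_main I J (by simp [J]; omega) (by simp [I, J]; omega) T
        (h1 ▸ Flat.nodup_flat σ) (fun x => h1 ▸ Flat.mem_flat σ x), pow_add]
    congr 2
    simp [I, J]
end

section
/- Let n ≥ 3 and let i, j be integers with 3 ≤ i < j ≤ n. Then g_n(1ij) = g_{n-1}(1(j-1)) in ℤ[q]. -/
open Finset Polynomial

theorem fp_countP_sum (P : ℕ → Bool) (w : List ℕ) :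
    ∑ y ∈ Finset.range w.length, (if P (w.getD y 0) then 1 else 0) = w.countP P := by
  induction w with
  | nil => simp
  | cons a w ih =>
    rw [List.length_cons, Finset.sum_range_succ', List.countP_cons]
    simp only [List.getD_cons_succ, List.getD_cons_zero]
    rw [ih]

theorem fp_occ_cons (a b : ℕ) (w : List ℕ) :
    occ (a :: b :: w) = w.countP (fun c => decide (a < c ∧ c < b)) + occ (b :: w) := by
  have h := fp_countP_sum (fun c => decide (a < c ∧ c < b)) w
  rw [← h]
  unfold occ
  rw [Finset.card_filter, Finset.card_filter, Finset.sum_product, Finset.sum_product]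
  simp only [List.length_cons]
  rw [Finset.sum_range_succ', Finset.sum_range_succ']
  rw [Finset.sum_range_succ' _ w.length]
  simp only [Finset.sum_range_succ']
  simp [add_comm, add_left_comm]

theorem fp_occ_map (s : ℕ → ℕ) (hs : StrictMono s) (w : List ℕ) :
    occ (w.map s) = occ w := by
  induction w with
  | nil => simp
  | cons a w ih =>
    cases w with
    | nil =>
      have h1 : ∀ x : ℕ, occ [x] = 0 := by
        intro x
        unfold occ
        rw [Finset.card_eq_zero, Finset.filter_eq_empty_iff]
        simp
      simp [h1]
    | cons b w =>
      simp only [List.map_cons] at ih ⊢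
      rw [fp_occ_cons, fp_occ_cons, ih, List.countP_map]
      congr 2
      funext c
      simp [hs.lt_iff_lt]

/-- insertion of `p` right after `0` in its cycle -/
def fpIns {k : ℕ} (p : Fin (k+2)) (σ : Equiv.Perm (Fin (k+1))) : Equiv.Perm (Fin (k+2)) :=
  Equiv.swap 0 p |>.trans
    ((finSuccEquiv' p).trans ((Equiv.optionCongr σ).trans (finSuccEquiv' p).symm))

theorem fpIns_zero {k : ℕ} (p : Fin (k+2)) (σ : Equiv.Perm (Fin (k+1))) :
    fpIns p σ 0 = p := by
  simp [fpIns]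

theorem fp_sA_zero {k : ℕ} (p : Fin (k+2)) (hp : p ≠ 0) : p.succAbove (0 : Fin (k+1)) = 0 :=
  Fin.succAbove_ne_zero_zero hp

theorem fpIns_p {k : ℕ} (p : Fin (k+2)) (hp : p ≠ 0) (σ : Equiv.Perm (Fin (k+1))) :
    fpIns p σ p = p.succAbove (σ 0) := by
  have : finSuccEquiv' p 0 = some 0 := by
    conv_lhs => rw [← fp_sA_zero p hp]
    simp
  simp [fpIns, this]

theorem fpIns_sA {k : ℕ} (p : Fin (k+2)) (hp : p ≠ 0) (σ : Equiv.Perm (Fin (k+1)))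
    (a : Fin (k+1)) (ha : a ≠ 0) :
    fpIns p σ (p.succAbove a) = p.succAbove (σ a) := by
  have h1 : p.succAbove a ≠ 0 := by
    rw [← fp_sA_zero p hp]; simpa using ha
  have h2 : p.succAbove a ≠ p := Fin.succAbove_ne p a
  simp [fpIns, Equiv.swap_apply_of_ne_of_ne h1 h2]

theorem fpIns_inj {k : ℕ} (p : Fin (k+2)) : Function.Injective (fpIns p) := by
  intro σ τ h
  have h' : Equiv.optionCongr σ = Equiv.optionCongr τ := by
    ext1 x
    have := congrArg (fun e => e (Equiv.swap 0 p ((finSuccEquiv' p).symm x))) h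
    simpa [fpIns] using this
  exact Equiv.optionCongr_injective h'

theorem fpIns_surj {k : ℕ} (p : Fin (k+2)) (π : Equiv.Perm (Fin (k+2))) (h : π 0 = p) :
    ∃ σ, fpIns p σ = π := by
  let e : Equiv.Perm (Option (Fin (k+1))) :=
    (finSuccEquiv' p).symm.trans ((Equiv.swap 0 p).trans (π.trans (finSuccEquiv' p)))
  have he : e none = none := by simp [e, h]
  refine ⟨Equiv.removeNone e, ?_⟩
  have h2 : Equiv.optionCongr (Equiv.removeNone e) = e := by
    ext1 x
    cases x with
    | none => simp [he]
    | some x => simp [he]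
  unfold fpIns
  rw [h2]
  ext1 x
  simp [e]

theorem fp_iter {n : ℕ} (π : Equiv.Perm (Fin n)) (k : ℕ) (x : Fin n) : (π ^ k) x = π^[k] x := by
  rw [← Equiv.Perm.iterate_eq_pow]

theorem fp_pos {n : ℕ} (π : Equiv.Perm (Fin n)) (x : Fin n) :
    0 < Function.minimalPeriod π x := by
  apply Function.minimalPeriod_pos_of_mem_periodicPts
  exact Function.Injective.mem_periodicPts π.injective x

theorem fp_mem {n : ℕ} (π : Equiv.Perm (Fin n)) (x y : Fin n) :
    y ∈ cycleList π x ↔ ∃ k : ℕ, (π ^ k) x = y := by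
  unfold cycleList
  simp only [List.mem_map, List.mem_range]
  constructor
  · rintro ⟨k, -, h⟩; exact ⟨k, h⟩
  · rintro ⟨k, h⟩
    refine ⟨k % Function.minimalPeriod π x, Nat.mod_lt _ (fp_pos π x), ?_⟩
    rw [← h, fp_iter, fp_iter, Function.iterate_mod_minimalPeriod_eq]

theorem fp_mem_symm {n : ℕ} (π : Equiv.Perm (Fin n)) (x y : Fin n)
    (h : y ∈ cycleList π x) : x ∈ cycleList π y := by
  have h' : ∀ a b, b ∈ cycleList π a ↔ π.SameCycle a b := by
    intro a b
    rw [fp_mem]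
    constructor
    · rintro ⟨k, hk⟩; exact ⟨k, by simpa using hk⟩
    · intro hs
      obtain ⟨i, -, hi⟩ := hs.exists_pow_eq'
      exact ⟨i, hi⟩
  rw [h'] at h ⊢
  exact h.symm

theorem fp_mem_mins {n : ℕ} (π : Equiv.Perm (Fin n)) (x : Fin n) :
    x ∈ cycleMins π ↔ ∀ y ∈ cycleList π x, x ≤ y := by
  unfold cycleMins
  rw [Finset.mem_sort, Finset.mem_filter]
  constructor
  · rintro ⟨-, h⟩ y hy
    unfold cycleList at hy
    simp only [List.mem_map, List.mem_range] at hy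
    obtain ⟨k, hk, rfl⟩ := hy
    apply h
    have : Function.minimalPeriod π x ≤ n := by
      simpa using Function.minimalPeriod_le_card (f := π) (x := x)
    omega
  · intro h
    refine ⟨Finset.mem_univ _, fun k _ => h _ ?_⟩
    rw [fp_mem]; exact ⟨k, rfl⟩

theorem fp_cycle_off {k : ℕ} (p : Fin (k+2)) (hp : p ≠ 0) (σ : Equiv.Perm (Fin (k+1)))
    (a : Fin (k+1)) (ha : (0 : Fin (k+1)) ∉ cycleList σ a) :
    cycleList (fpIns p σ) (p.succAbove a) = (cycleList σ a).map p.succAbove := by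
  have h : ∀ t : ℕ, ((fpIns p σ) ^ t) (p.succAbove a) = p.succAbove ((σ ^ t) a) := by
    intro t
    induction t with
    | zero => simp
    | succ t ih =>
      rw [pow_succ', pow_succ', Equiv.Perm.mul_apply, Equiv.Perm.mul_apply, ih, fpIns_sA p hp]
      intro h0
      exact ha ((fp_mem _ _ _).2 ⟨t, h0⟩)
  have hT : Function.minimalPeriod (fpIns p σ) (p.succAbove a) = Function.minimalPeriod σ a := by
    rw [Function.minimalPeriod_eq_minimalPeriod_iff]
    intro t
    unfold Function.IsPeriodicPt Function.IsFixedPt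
    rw [← fp_iter, ← fp_iter, h]
    exact Fin.succAbove_right_inj
  unfold cycleList
  rw [hT, List.map_map]
  apply List.map_congr_left
  intro t _
  exact h t

theorem fp_cycle_zero {k : ℕ} (p : Fin (k+2)) (hp : p ≠ 0) (σ : Equiv.Perm (Fin (k+1))) :
    ∃ l, cycleList σ 0 = 0 :: l ∧ cycleList (fpIns p σ) 0 = 0 :: p :: l.map p.succAbove := by
  obtain ⟨t, ht⟩ := Nat.exists_eq_succ_of_ne_zero (fp_pos σ 0).ne'
  have hne : ∀ s, s < t → (σ ^ (s+1)) 0 ≠ 0 := by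
    intro s hs h0
    rw [fp_iter] at h0
    have : Function.IsPeriodicPt σ (s+1) 0 := h0
    have := this.minimalPeriod_le (Nat.succ_pos s)
    omega
  have h : ∀ s : ℕ, s ≤ t → ((fpIns p σ) ^ (s+2)) 0 = p.succAbove ((σ ^ (s+1)) 0) := by
    intro s
    induction s with
    | zero =>
      intro _
      simp [pow_two, fpIns_zero, fpIns_p p hp]
    | succ s ih =>
      intro hs
      rw [pow_succ', pow_succ' σ, Equiv.Perm.mul_apply, Equiv.Perm.mul_apply, ih (by omega),
        fpIns_sA p hp]
      exact hne s (by omega)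
  have hT : Function.minimalPeriod (fpIns p σ) 0 = t + 2 := by
    have hper : Function.IsPeriodicPt (fpIns p σ) (t+2) 0 := by
      unfold Function.IsPeriodicPt Function.IsFixedPt
      rw [← fp_iter, h t le_rfl]
      have : (σ ^ (t+1)) 0 = 0 := by
        rw [fp_iter, show t + 1 = Function.minimalPeriod σ 0 from ht.symm]
        exact Function.iterate_minimalPeriod
      rw [this, fp_sA_zero p hp]
    apply le_antisymm (hper.minimalPeriod_le (by omega))
    by_contra hlt
    have h0 : ((fpIns p σ) ^ (Function.minimalPeriod (fpIns p σ) 0)) 0 = 0 := by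
      rw [fp_iter]; exact Function.iterate_minimalPeriod
    have hpos := fp_pos (fpIns p σ) 0
    generalize Function.minimalPeriod (fpIns p σ) 0 = T at *
    match T, hpos with
    | 1, _ =>
      rw [pow_one, fpIns_zero] at h0; exact hp h0
    | s + 2, _ =>
      rw [h s (by omega), ← fp_sA_zero p hp] at h0
      rw [Fin.succAbove_right_inj] at h0
      exact hne s (by omega) h0
  refine ⟨(List.range t).map (fun s => (σ ^ (s+1)) 0), ?_, ?_⟩
  · unfold cycleList
    rw [ht, List.range_succ_eq_map]
    simp [List.map_map, Function.comp_def]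
  · unfold cycleList
    rw [hT, List.range_succ_eq_map, List.range_succ_eq_map]
    simp only [List.map_cons, List.map_map, pow_zero, Equiv.Perm.one_apply, Function.comp_def]
    congr 1
    congr 1
    · simp [fpIns_zero]
    · apply List.map_congr_left
      intro s hs
      exact h s (List.mem_range.1 hs).le

theorem fp_mins_sorted {n : ℕ} (π : Equiv.Perm (Fin n)) : (cycleMins π).Pairwise (· < ·) := by
  unfold cycleMins
  exact (Finset.sortedLT_sort _).pairwise

theorem fp_mins_ins {k : ℕ} (p : Fin (k+2)) (hp : p ≠ 0) (σ : Equiv.Perm (Fin (k+1))) :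
    cycleMins (fpIns p σ) = (cycleMins σ).map p.succAbove := by
  have hmem : ∀ x, x ∈ cycleMins (fpIns p σ) ↔ x ∈ (cycleMins σ).map p.succAbove := by
    obtain ⟨l, hl, hl'⟩ := fp_cycle_zero p hp σ
    intro x
    have hbad : ∀ {n : ℕ} (π : Equiv.Perm (Fin (n+1))) (y : Fin (n+1)), y ≠ 0 →
        y ∈ cycleList π 0 → y ∉ cycleMins π := by
      intro n π y hy hy0 hmin
      have := (fp_mem_mins π y).1 hmin 0 (fp_mem_symm _ _ _ hy0)
      exact hy (Fin.le_zero_iff.1 this)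
    rcases Fin.eq_self_or_eq_succAbove p x with rfl | ⟨a, rfl⟩
    · have h1 := hbad (fpIns x σ) x hp (by rw [hl']; simp)
      simp [h1, Fin.succAbove_ne]
    · rw [List.mem_map_of_injective Fin.succAbove_right_injective]
      by_cases ha0 : a = 0
      · subst ha0
        rw [fp_sA_zero p hp, fp_mem_mins, fp_mem_mins]
        simp
      by_cases ha : a ∈ cycleList σ 0
      · have h1 := hbad σ a ha0 ha
        have h2 := hbad (fpIns p σ) (p.succAbove a)
          (by rw [← fp_sA_zero p hp]; simpa using ha0)
          (by
            rw [hl] at ha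
            rw [hl']
            simp only [List.mem_cons, ha0, false_or] at ha
            simp [ha])
        simp [h1, h2]
      · have ha' : (0 : Fin (k+1)) ∉ cycleList σ a := fun h => ha (fp_mem_symm _ _ _ h)
        rw [fp_mem_mins, fp_mem_mins, fp_cycle_off p hp σ a ha']
        simp
  have hs1 := fp_mins_sorted (fpIns p σ)
  have hs2 : ((cycleMins σ).map p.succAbove).Pairwise (· < ·) := by
    rw [List.pairwise_map]
    exact (fp_mins_sorted σ).imp (fun h => (Fin.strictMono_succAbove p) h)
  have hperm : (cycleMins (fpIns p σ)).Perm ((cycleMins σ).map p.succAbove) := by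
    rw [List.perm_ext_iff_of_nodup (hs1.imp (fun h => h.ne)) (hs2.imp (fun h => h.ne))]
    exact hmem
  exact hperm.eq_of_pairwise (fun a b _ _ h1 h2 => absurd (h1.trans h2) (lt_irrefl _)) hs1 hs2

theorem fp_mins_cons {k : ℕ} (σ : Equiv.Perm (Fin (k+1))) :
    ∃ r, cycleMins σ = 0 :: r ∧ r.Pairwise (· < ·) ∧ (∀ x ∈ r, x ≠ 0) := by
  have h0 : (0 : Fin (k+1)) ∈ cycleMins σ := by rw [fp_mem_mins]; simp
  have hs := fp_mins_sorted σ
  cases hc : cycleMins σ with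
  | nil => simp [hc] at h0
  | cons a r =>
    rw [hc] at h0 hs
    rw [List.pairwise_cons] at hs
    have ha : a = 0 := by
      rcases List.mem_cons.1 h0 with h | h
      · exact h.symm
      · exact absurd (hs.1 0 h) (by simp)
    subst ha
    exact ⟨r, rfl, hs.2, fun x hx => (hs.1 x hx).ne'⟩

def fpS (p x : ℕ) : ℕ := if x < p then x else x + 1

theorem fpS_mono (p : ℕ) : StrictMono (fpS p) := by
  intro a b h
  unfold fpS
  split_ifs <;> omega

theorem fp_flatten_eq {n : ℕ} (π : Equiv.Perm (Fin n)) :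
    flattenPerm π =
      ((cycleMins π).map (cycleList π)).flatten.map (fun m : Fin n => (m : ℕ) + 1) := by
  unfold flattenPerm
  generalize ((cycleMins π).map (cycleList π)).flatten = l
  induction l with
  | nil => simp
  | cons a l ih => simpa using ih

theorem fp_flatten_ins {k : ℕ} (p : Fin (k+2)) (hp : p ≠ 0) (σ : Equiv.Perm (Fin (k+1))) :
    ∃ t, flattenPerm σ = 1 :: t ∧
      flattenPerm (fpIns p σ) = 1 :: ((p : ℕ) + 1) :: t.map (fpS (p + 1)) := by
  obtain ⟨l, hl, hl'⟩ := fp_cycle_zero p hp σ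
  obtain ⟨r, hr, -, hr0⟩ := fp_mins_cons σ
  have hoff : (r.map p.succAbove).map (cycleList (fpIns p σ)) =
      (r.map (cycleList σ)).map (List.map p.succAbove) := by
    rw [List.map_map, List.map_map]
    apply List.map_congr_left
    intro a ha
    apply fp_cycle_off p hp
    intro h0
    have hm : a ∈ cycleMins σ := by rw [hr]; simp [ha]
    exact hr0 a ha (Fin.le_zero_iff.1 ((fp_mem_mins σ a).1 hm 0 h0))
  have hval : ∀ a : Fin (k+1), ((p.succAbove a : Fin (k+2)) : ℕ) + 1 = fpS (p+1) (a + 1) := by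
    intro a
    unfold fpS
    simp only [Fin.succAbove, Fin.lt_def]
    simp only [Fin.val_castSucc]
    split_ifs <;> simp <;> omega
  refine ⟨(l ++ (r.map (cycleList σ)).flatten).map (fun m : Fin (k+1) => (m : ℕ) + 1), ?_, ?_⟩
  · rw [fp_flatten_eq]
    rw [hr]
    simp [hl]
  · rw [fp_flatten_eq]
    rw [fp_mins_ins p hp, hr, List.map_cons, List.map_cons, fp_sA_zero p hp, hl', hoff,
      List.flatten_cons, ← List.map_flatten]
    simp only [List.map_cons, List.cons_append, List.map_append, List.map_map]
    congr 2
    simp [Function.comp_def, hval]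

theorem fp_snd {k : ℕ} (π : Equiv.Perm (Fin (k+2))) (i : ℕ) (hi : 3 ≤ i) (w : List ℕ)
    (h : (1 :: i :: w) <+: flattenPerm π) : ((π 0 : Fin (k+2)) : ℕ) + 1 = i := by
  obtain ⟨r, hr, hrs, hr0⟩ := fp_mins_cons π
  have hpos := fp_pos π 0
  rw [fp_flatten_eq] at h
  rw [hr] at h
  by_cases hπ : π 0 = 0
  · exfalso
    have hc : cycleList π 0 = [0] := by
      have : Function.minimalPeriod π 0 = 1 :=
        Function.minimalPeriod_eq_one_iff_isFixedPt.2 hπ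
      simp [cycleList, this]
    have h1 : (1 : Fin (k+2)) ∈ r := by
      have : (1 : Fin (k+2)) ∈ cycleMins π := by
        rw [fp_mem_mins]
        intro y hy
        have : y ≠ 0 := by
          rintro rfl
          have := fp_mem_symm _ _ _ hy
          simp [hc] at this
        rw [Fin.le_def]
        have : (y : ℕ) ≠ 0 := fun h => this (Fin.ext h)
        simp; omega
      rw [hr] at this
      simpa using this
    cases r with
    | nil => simp at h1
    | cons b r =>
      have hb : b = 1 := by
        rw [List.pairwise_cons] at hrs
        have hb0 := hr0 b (by simp)
        rcases List.mem_cons.1 h1 with h1 | h1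
        · exact h1.symm
        · have := hrs.1 1 h1
          exfalso
          apply hb0
          apply Fin.ext
          rw [Fin.lt_def] at this
          simp at this ⊢
          omega
      subst hb
      obtain ⟨t, ht⟩ := Nat.exists_eq_succ_of_ne_zero (fp_pos π 1).ne'
      have hc1 : ∃ l, cycleList π 1 = 1 :: l := by
        unfold cycleList
        rw [ht, List.range_succ_eq_map]
        exact ⟨_, by simp; rfl⟩
      obtain ⟨l, hl⟩ := hc1
      simp [hc, hl] at h
      omega
  · obtain ⟨t, ht⟩ : ∃ t, Function.minimalPeriod π 0 = t + 2 := by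
      refine ⟨Function.minimalPeriod π 0 - 2, ?_⟩
      have : Function.minimalPeriod π 0 ≠ 1 := fun h =>
        hπ (Function.minimalPeriod_eq_one_iff_isFixedPt.1 h)
      omega
    have hc : ∃ l, cycleList π 0 = 0 :: π 0 :: l := by
      unfold cycleList
      rw [ht, List.range_succ_eq_map, List.range_succ_eq_map]
      exact ⟨_, by simp; rfl⟩
    obtain ⟨l, hl⟩ := hc
    simp [hl] at h
    omega

theorem fp_word (i j : ℕ) (hi : 3 ≤ i) (hij : i < j) (t : List ℕ) :
    ([1, i, j] <+: (1 :: i :: t.map (fpS i)) ↔ [1, j - 1] <+: (1 :: t)) ∧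
    ([1, j - 1] <+: (1 :: t) → occ (1 :: i :: t.map (fpS i)) = occ (1 :: t)) := by
  cases t with
  | nil => simp
  | cons b t =>
    have hb : j = fpS i b ↔ j - 1 = b := by
      unfold fpS; split_ifs <;> omega
    constructor
    · simp [hb]
    · intro h
      have hb' : j - 1 = b := by simpa using h
      have hj : fpS i b = j := (hb.2 hb').symm
      have hocc := fp_occ_map (fpS i) (fpS_mono i) (b :: t)
      rw [fp_occ_cons 1 b, ← hocc]
      simp only [List.map_cons, hj]
      rw [fp_occ_cons, fp_occ_cons, ← add_assoc]
      congr 1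
      rw [List.countP_cons, if_neg (by simp; omega)]
      clear hocc h
      induction t with
      | nil => simp
      | cons c t ih =>
        simp only [List.map_cons, List.countP_cons]
        rw [← ih]
        unfold fpS
        simp only [decide_eq_true_eq]
        split_ifs <;> omega

/-- For `n ≥ 3`, `3 ≤ i < j ≤ n`,
`g_n(1ij) = g_{n-1}(1(j-1))` in `ℤ[q]`. -/
theorem gPrefix_three_letters_gt (n i j : ℕ) (hn : 3 ≤ n) (hi : 3 ≤ i) (hij : i < j)
    (hjn : j ≤ n) :
    gPrefix n [1, i, j] = gPrefix (n - 1) [1, j - 1] := by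
  obtain ⟨k, rfl⟩ : ∃ k, n = k + 2 := ⟨n - 2, by omega⟩
  have hk : k + 2 - 1 = k + 1 := rfl
  rw [hk]
  obtain ⟨p, hpi⟩ : ∃ p : Fin (k+2), (p : ℕ) + 1 = i := ⟨⟨i - 1, by omega⟩, by simp; omega⟩
  have hp : p ≠ 0 := by rintro rfl; simp at hpi; omega
  unfold gPrefix
  symm
  have key : ∀ σ : Equiv.Perm (Fin (k+1)),
      ([1, i, j] <+: flattenPerm (fpIns p σ) ↔ [1, j - 1] <+: flattenPerm σ) ∧
      ([1, j - 1] <+: flattenPerm σ → occ (flattenPerm (fpIns p σ)) = occ (flattenPerm σ)) := by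
    intro σ
    obtain ⟨t, h1, h2⟩ := fp_flatten_ins p hp σ
    rw [h1, h2, hpi]
    exact fp_word i j hi hij t
  refine Finset.sum_bij (fun σ _ => fpIns p σ) ?_ ?_ ?_ ?_
  · intro σ hσ
    simp only [Finset.mem_filter, Finset.mem_univ, true_and] at hσ ⊢
    exact (key σ).1.2 hσ
  · intro a _ b _ h
    exact fpIns_inj p h
  · intro π hπ
    simp only [Finset.mem_filter, Finset.mem_univ, true_and] at hπ
    have h0 := fp_snd π i hi _ hπ
    obtain ⟨σ, rfl⟩ := fpIns_surj p π (Fin.ext (by omega))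
    refine ⟨σ, ?_, rfl⟩
    simp only [Finset.mem_filter, Finset.mem_univ, true_and]
    exact (key σ).1.1 hπ
  · intro σ hσ
    simp only [Finset.mem_filter, Finset.mem_univ, true_and] at hσ
    rw [(key σ).2 hσ]
end

section
/- For all integers n ≥ 3 and 3 ≤ k ≤ n, one has g_n(1k) = Σ_{j=1}^{k-1} a_{k,j}·(q−1)^{j-1}·g_{n-j} in ℤ[q], where the polynomials a_{k,j} ∈ ℤ[q] (k ≥ 2, j ∈ ℤ) are defined by a_{2,j} = 1 if j = 1 and 0 otherwise, a_{3,j} = j if j ∈ {1,2} and 0 otherwise, and a_{k,j} = (1+q)·a_{k-1,j} − q·a_{k-2,j} + a_{k-1,j-1} for k ≥ 4. -/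
open Finset Polynomial

/-- The double sequence `a_{k,j} ∈ ℤ[q]` of the paper:
`a_{2,j} = χ(j=1)`, `a_{3,j} = j·χ(j∈{1,2})`, and
`a_{k,j} = (1+q)a_{k-1,j} − q·a_{k-2,j} + a_{k-1,j-1}` for `k ≥ 4`. -/
noncomputable def aP : ℕ → ℤ → Polynomial ℤ
  | 0, _ => 0
  | 1, _ => 0
  | 2, j => if j = 1 then 1 else 0
  | 3, j => if j = 1 then 1 else if j = 2 then 2 else 0
  | (k + 4), j => (1 + X) * aP (k + 3) j - X * aP (k + 2) j + aP (k + 3) (j - 1)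

/-! ### Recursive form of `occ` -/

def occL : List ℕ → ℕ
  | [] => 0
  | [_] => 0
  | a :: c :: l => l.countP (fun x => a < x ∧ x < c) + occL (c :: l)

lemma occ_eq_sum (w : List ℕ) : occ w = ∑ i ∈ Finset.range w.length, ∑ j ∈ Finset.range w.length,
    if (1 ≤ i ∧ i < j ∧ w.getD (i - 1) 0 < w.getD j 0 ∧ w.getD j 0 < w.getD i 0) then 1 else 0 := by
  unfold occ
  rw [Finset.card_filter, Finset.sum_product]

lemma countP_eq_sum (p : ℕ → Prop) [DecidablePred p] (l : List ℕ) :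
    l.countP (fun x => p x) = ∑ j ∈ Finset.range l.length, if p (l.getD j 0) then 1 else 0 := by
  induction l with
  | nil => simp
  | cons a l ih =>
    rw [List.length_cons, Finset.sum_range_succ', List.countP_cons, ih]
    simp

lemma occ_cons_cons (a c : ℕ) (l : List ℕ) :
    occ (a :: c :: l) = l.countP (fun x => a < x ∧ x < c) + occ (c :: l) := by
  rw [countP_eq_sum (fun x => a < x ∧ x < c), occ_eq_sum, occ_eq_sum]
  simp only [List.length_cons]
  rw [Finset.sum_range_succ' _ (l.length + 1)]
  have z : ∀ f : ℕ → Prop, ∀ N : ℕ, ∀ _ : DecidablePred f,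
      (∑ j ∈ Finset.range N, if (1 ≤ 0 ∧ f j) then 1 else 0) = 0 := by
    intro f N _; simp
  rw [z, add_zero, Finset.sum_range_succ' _ l.length, Finset.sum_range_succ' _ l.length, z,
    add_zero, add_comm]
  congr 1
  · rw [Finset.sum_range_succ', Finset.sum_range_succ']
    simp
  · refine Finset.sum_congr rfl fun i _ => ?_
    rw [Finset.sum_range_succ' _ (l.length + 1)]
    simp

lemma occ_eq_occL : ∀ w : List ℕ, occ w = occL w
  | [] => by simp [occ, occL]
  | [a] => by simp [occ_eq_sum, occL]
  | a :: c :: l => by rw [occ_cons_cons, occL, occ_eq_occL (c :: l)]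

/-! ### Marked words -/

def marks (S : Finset ℕ) (a : ℕ) : Finset Bool := if ∀ x ∈ S, a ≤ x then Finset.univ else {false}

def wordsFrom (W : Finset ℕ → Finset (List (ℕ × Bool))) (S : Finset ℕ) (a : ℕ) :
    Finset (List (ℕ × Bool)) :=
  (marks S a ×ˢ W (S.erase a)).image (fun p => (a, p.1) :: p.2)

def words : ℕ → Finset ℕ → Finset (List (ℕ × Bool))
  | 0, _ => {[]}
  | m + 1, S => S.biUnion (wordsFrom (words m) S)

def rank (S : Finset ℕ) (a : ℕ) : ℕ := (S.filter (· < a)).card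

lemma mem_wordsFrom {W S a l} : l ∈ wordsFrom W S a ↔
    ∃ b l', b ∈ marks S a ∧ l' ∈ W (S.erase a) ∧ l = (a, b) :: l' := by
  simp only [wordsFrom, Finset.mem_image, Finset.mem_product, Prod.exists]
  constructor
  · rintro ⟨b, l', ⟨h1, h2⟩, rfl⟩; exact ⟨b, l', h1, h2, rfl⟩
  · rintro ⟨b, l', h1, h2, rfl⟩; exact ⟨b, l', ⟨h1, h2⟩, rfl⟩

lemma words_countP (p : ℕ → Prop) [DecidablePred p] : ∀ (m : ℕ) (S : Finset ℕ), S.card = m →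
    ∀ l ∈ words m S, (l.map Prod.fst).countP (fun x => p x) = (S.filter p).card := by
  intro m
  induction m with
  | zero =>
    intro S hS l hl
    rw [Finset.card_eq_zero] at hS
    subst hS
    simp [words] at hl
    simp [hl]
  | succ m ih =>
    intro S hS l hl
    simp only [words, Finset.mem_biUnion, mem_wordsFrom] at hl
    obtain ⟨a, ha, b, l', -, hl', rfl⟩ := hl
    have h1 : (S.erase a).card = m := by rw [Finset.card_erase_of_mem ha]; omega
    have := ih _ h1 l' hl'
    rw [List.map_cons, List.countP_cons, this]
    rw [Finset.filter_erase]
    by_cases hp : p a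
    · have : a ∈ S.filter p := by simp [ha, hp]
      rw [Finset.card_erase_of_mem this]
      have : 0 < (S.filter p).card := Finset.card_pos.mpr ⟨a, this⟩
      simp [hp]; omega
    · rw [Finset.erase_eq_of_notMem (by simp [hp])]
      simp [hp]

lemma sum_words_succ {M : Type*} [AddCommMonoid M] (m : ℕ) (S : Finset ℕ)
    (f : List (ℕ × Bool) → M) :
    ∑ l ∈ words (m + 1) S, f l = ∑ c ∈ S, ∑ l ∈ wordsFrom (words m) S c, f l := by
  rw [words, Finset.sum_biUnion]
  intro a _ b _ hab
  rw [Function.onFun, Finset.disjoint_left]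
  intro l h1 h2
  rw [mem_wordsFrom] at h1 h2
  obtain ⟨_, _, _, _, rfl⟩ := h1
  obtain ⟨_, _, _, _, h⟩ := h2
  simp at h
  exact hab h.1.1

lemma sum_wordsFrom {M : Type*} [AddCommMonoid M] (W : Finset ℕ → Finset (List (ℕ × Bool)))
    (S : Finset ℕ) (a : ℕ) (f : List (ℕ × Bool) → M) :
    ∑ l ∈ wordsFrom W S a, f l = ∑ b ∈ marks S a, ∑ l ∈ W (S.erase a), f ((a, b) :: l) := by
  rw [wordsFrom, Finset.sum_image, Finset.sum_product]
  rintro ⟨b, l⟩ _ ⟨b', l'⟩ _ h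
  simpa using h

section weights
variable {R : Type*} [CommRing R] (q : R)

def HH : ℕ → ℕ → R
  | 0, r => if r = 0 then 2 else 1
  | m + 1, r => (if r = 0 then 2 else 1) * ∑ j ∈ Finset.range (m + 1), q ^ (j - r) * HH m j

def wt (l : List (ℕ × Bool)) : R := q ^ occL (l.map Prod.fst)

lemma sum_wordsFrom_cons (m : ℕ) (S : Finset ℕ) (hS : S.card = m + 1) (a c : ℕ) (b : Bool)
    (hc : c ∈ S) :
    ∑ l ∈ wordsFrom (words m) S c, wt q ((a, b) :: l) =
      q ^ (S.filter (fun x => a < x ∧ x < c)).card * ∑ l ∈ wordsFrom (words m) S c, wt q l := by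
  rw [Finset.mul_sum]
  refine Finset.sum_congr rfl fun l hl => ?_
  rw [mem_wordsFrom] at hl
  obtain ⟨b', l', -, hl', rfl⟩ := hl
  have h1 : (S.erase c).card = m := by rw [Finset.card_erase_of_mem hc]; omega
  simp only [wt, List.map_cons, occL]
  rw [words_countP (fun x => a < x ∧ x < c) m _ h1 l' hl', pow_add, Finset.filter_erase,
    Finset.erase_eq_of_notMem (by simp)]

lemma rank_lt (S : Finset ℕ) {c : ℕ} (hc : c ∈ S) : rank S c < S.card :=
  Finset.card_lt_card (by
    rw [Finset.ssubset_iff_of_subset (Finset.filter_subset _ _)]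
    exact ⟨c, hc, by simp⟩)

lemma rank_strictMono (S : Finset ℕ) {c d : ℕ} (hc : c ∈ S) (h : c < d) : rank S c < rank S d :=
  Finset.card_lt_card (by
    rw [Finset.ssubset_iff_of_subset]
    · exact ⟨c, by simp [hc, h], by simp⟩
    · intro x; simp; intro hx h1; exact ⟨hx, by omega⟩)

lemma sum_rank {M : Type*} [AddCommMonoid M] (S : Finset ℕ) (f : ℕ → M) :
    ∑ c ∈ S, f (rank S c) = ∑ j ∈ Finset.range S.card, f j := by
  have hinj : Set.InjOn (rank S) S := by
    intro c hc d hd h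
    rcases lt_trichotomy c d with h1 | h1 | h1
    · have := rank_strictMono S hc h1; omega
    · exact h1
    · have := rank_strictMono S hd h1; omega
  have : S.image (rank S) = Finset.range S.card := by
    apply Finset.eq_of_subset_of_card_le
    · intro x hx
      obtain ⟨c, hc, rfl⟩ := Finset.mem_image.mp hx
      exact Finset.mem_range.mpr (rank_lt S hc)
    · rw [Finset.card_image_of_injOn hinj]; simp
  rw [← this, Finset.sum_image hinj]

lemma card_between (S : Finset ℕ) (a c : ℕ) (ha : a ∉ S) :
    (S.filter (fun x => a < x ∧ x < c)).card = rank S c - rank S a := by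
  rcases le_or_gt c a with h | h
  · have h1 : rank S c ≤ rank S a := Finset.card_le_card (by
      intro x; simp; intro hx h1; exact ⟨hx, by omega⟩)
    have : S.filter (fun x => a < x ∧ x < c) = ∅ := by
      apply Finset.filter_eq_empty_iff.mpr; intro x _; omega
    rw [this]; simp; omega
  · have : S.filter (fun x => a < x ∧ x < c) = S.filter (· < c) \ S.filter (· < a) := by
      ext x
      simp only [Finset.mem_filter, Finset.mem_sdiff]
      constructor
      · rintro ⟨h1, h2, h3⟩; exact ⟨⟨h1, h3⟩, fun h => by omega⟩
      · rintro ⟨⟨h1, h2⟩, h3⟩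
        refine ⟨h1, ?_, h2⟩
        have : x ≠ a := fun h => ha (h ▸ h1)
        have : ¬ x < a := fun h => h3 ⟨h1, h⟩
        omega
    rw [this, Finset.card_sdiff_of_subset, rank, rank]
    intro x; simp; intro hx h1; exact ⟨hx, by omega⟩

lemma card_marks (S : Finset ℕ) (a : ℕ) :
    (((marks S a).card : ℕ) : R) = if rank S a = 0 then 2 else 1 := by
  have : rank S a = 0 ↔ ∀ x ∈ S, a ≤ x := by
    rw [rank, Finset.card_eq_zero, Finset.filter_eq_empty_iff]; simp
  rw [marks]
  by_cases h : ∀ x ∈ S, a ≤ x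
  · rw [if_pos h, if_pos (this.mpr h)]; simp
  · rw [if_neg h, if_neg (fun h' => h (this.mp h'))]; simp

lemma sum_words_cons_of (m : ℕ) (S : Finset ℕ) (hS : S.card = m + 1) (a : ℕ) (b : Bool)
    (ha : a ∉ S)
    (ih : ∀ c ∈ S, ∑ l ∈ wordsFrom (words m) S c, wt q l = HH q m (rank S c)) :
    ∑ l ∈ words (m + 1) S, wt q ((a, b) :: l) =
      ∑ j ∈ Finset.range (m + 1), q ^ (j - rank S a) * HH q m j := by
  rw [sum_words_succ, ← hS, ← sum_rank S (fun j => q ^ (j - rank S a) * HH q m j)]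
  refine Finset.sum_congr rfl fun c hc => ?_
  rw [sum_wordsFrom_cons q m S hS a c b hc, ih c hc, card_between S a c ha]

lemma sum_wordsFrom_eq : ∀ (m : ℕ) (S : Finset ℕ), S.card = m + 1 → ∀ a ∈ S,
    ∑ l ∈ wordsFrom (words m) S a, wt q l = HH q m (rank S a) := by
  intro m
  induction m with
  | zero =>
    intro S hS a ha
    rw [sum_wordsFrom]
    simp [words, wt, occL, HH, card_marks]
  | succ m ih =>
    intro S hS a ha
    have h1 : (S.erase a).card = m + 1 := by rw [Finset.card_erase_of_mem ha]; omega
    have hr : rank (S.erase a) a = rank S a := by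
      rw [rank, rank, Finset.filter_erase, Finset.erase_eq_of_notMem (by simp)]
    rw [sum_wordsFrom, HH, ← card_marks, ← nsmul_eq_mul, ← Finset.sum_const]
    refine Finset.sum_congr rfl fun b _ => ?_
    rw [sum_words_cons_of q m _ h1 a b (by simp) (ih _ h1), hr]

lemma sum_words_cons (m : ℕ) (S : Finset ℕ) (hS : S.card = m + 1) (a : ℕ) (b : Bool)
    (ha : a ∉ S) :
    ∑ l ∈ words (m + 1) S, wt q ((a, b) :: l) =
      ∑ j ∈ Finset.range (m + 1), q ^ (j - rank S a) * HH q m j :=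
  sum_words_cons_of q m S hS a b ha (sum_wordsFrom_eq q m S hS)

end weights

lemma sum_HH_one (m : ℕ) :
    ∑ j ∈ Finset.range (m + 1), HH (1 : ℤ) m j = ((m + 2).factorial : ℤ) := by
  induction m with
  | zero => simp [HH]
  | succ m ih =>
    simp only [HH, one_pow, one_mul]
    rw [← Finset.sum_mul, ih, Finset.sum_range_succ']
    simp
    rw [Nat.factorial_succ (m + 2)]
    push_cast
    ring

lemma card_words (m : ℕ) (S : Finset ℕ) (hS : S.card = m + 1) (h0 : 0 ∉ S) :
    (words (m + 1) S).card = (m + 2).factorial := by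
  have := sum_words_cons (1 : ℤ) m S hS 0 false h0
  simp [wt] at this
  rw [sum_HH_one] at this
  exact_mod_cast this

lemma mem_words : ∀ (m : ℕ) (S : Finset ℕ) (l : List (ℕ × Bool)), l.length = m →
    (l.map Prod.fst).Nodup → (∀ x, x ∈ l.map Prod.fst ↔ x ∈ S) →
    l.Pairwise (fun p p' => p.2 = true → p.1 < p'.1) → l ∈ words m S := by
  intro m
  induction m with
  | zero => intro S l hl; simp [List.length_eq_zero_iff.mp hl, words]
  | succ m ih =>
    intro S l hl hnd hS hp
    obtain ⟨⟨a, b⟩, l, rfl⟩ := List.exists_cons_of_length_eq_add_one hl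
    simp only [List.map_cons, List.nodup_cons, List.pairwise_cons, List.length_cons] at *
    rw [words, Finset.mem_biUnion]
    refine ⟨a, (hS a).mp (by simp), mem_wordsFrom.mpr ⟨b, l, ?_, ?_, rfl⟩⟩
    · rw [marks]
      cases b
      · split_ifs <;> simp
      · rw [if_pos]; · simp
        intro x hx
        rcases List.mem_cons.mp ((hS x).mpr hx) with h | h
        · omega
        · obtain ⟨p, hp1, rfl⟩ := List.mem_map.mp h
          exact (hp.1 p hp1 rfl).le
    · refine ih _ _ (by omega) hnd.2 ?_ hp.2
      intro x
      rw [Finset.mem_erase, ← hS, List.mem_cons]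
      constructor
      · intro h; exact ⟨fun e => hnd.1 (e ▸ h), Or.inr h⟩
      · rintro ⟨h1, h2 | h2⟩
        · exact absurd h2 h1
        · exact h2

/-! ### From permutations to marked words -/

section perms
variable {n : ℕ}

noncomputable def cycTail (π : Equiv.Perm (Fin n)) (m : Fin n) : List (Fin n) :=
  (cycleList π m).tail

lemma minPer_pos (π : Equiv.Perm (Fin n)) (m : Fin n) : 0 < Function.minimalPeriod π m :=
  Function.minimalPeriod_pos_of_mem_periodicPts
    (Function.Injective.mem_periodicPts π.injective m)

lemma cycleList_eq (π : Equiv.Perm (Fin n)) (m : Fin n) :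
    cycleList π m = m :: cycTail π m := by
  rw [cycTail, cycleList]
  obtain ⟨p, hp⟩ : ∃ p, Function.minimalPeriod π m = p + 1 :=
    ⟨_, (Nat.succ_pred_eq_of_pos (minPer_pos π m)).symm⟩
  rw [hp, List.range_succ_eq_map]
  simp

lemma pow_mod (π : Equiv.Perm (Fin n)) (m : Fin n) (k : ℕ) :
    (π ^ (k % Function.minimalPeriod π m)) m = (π ^ k) m := by
  rw [← Equiv.Perm.iterate_eq_pow, ← Equiv.Perm.iterate_eq_pow]
  exact Function.iterate_mod_minimalPeriod_eq

lemma mem_cycleList (π : Equiv.Perm (Fin n)) (m x : Fin n) :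
    x ∈ cycleList π m ↔ ∃ k, (π ^ k) m = x := by
  simp only [cycleList, List.mem_map, List.mem_range]
  constructor
  · rintro ⟨k, -, h⟩; exact ⟨k, h⟩
  · rintro ⟨k, h⟩
    exact ⟨_, Nat.mod_lt k (minPer_pos π m), by rw [pow_mod, h]⟩

lemma cycleList_nodup (π : Equiv.Perm (Fin n)) (m : Fin n) : (cycleList π m).Nodup := by
  rw [cycleList]
  refine List.Nodup.map_on ?_ List.nodup_range
  intro i hi j hj h
  rw [List.mem_range] at hi hj
  rw [← Equiv.Perm.iterate_eq_pow, ← Equiv.Perm.iterate_eq_pow] at h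
  exact Function.iterate_injOn_Iio_minimalPeriod hi hj h

lemma minPer_le (π : Equiv.Perm (Fin n)) (m : Fin n) : Function.minimalPeriod π m ≤ n := by
  have := (cycleList_nodup π m).length_le_card
  simpa [cycleList] using this

lemma mem_cycleMins (π : Equiv.Perm (Fin n)) (m : Fin n) :
    m ∈ cycleMins π ↔ ∀ k, m ≤ (π ^ k) m := by
  simp only [cycleMins, Finset.mem_sort, Finset.mem_filter, Finset.mem_univ, true_and]
  constructor
  · intro h k
    rw [← pow_mod]
    exact h _ (lt_of_lt_of_le (Nat.mod_lt k (minPer_pos π m)) (minPer_le π m))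
  · intro h k _; exact h k

lemma cycleMins_sorted (π : Equiv.Perm (Fin n)) : (cycleMins π).Pairwise (· < ·) := by
  rw [cycleMins]
  exact Finset.sortedLT_sort _ |>.pairwise

lemma exists_back (π : Equiv.Perm (Fin n)) (m x : Fin n) (k : ℕ) (h : (π ^ k) m = x) :
    ∃ j, (π ^ j) x = m := by
  have : Equiv.Perm.SameCycle π x m := (show Equiv.Perm.SameCycle π m x from ⟨k, by simpa using h⟩).symm
  obtain ⟨j, -, -, h⟩ := this.exists_pow_eq π
  exact ⟨j, h⟩

lemma exists_min (π : Equiv.Perm (Fin n)) (x : Fin n) :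
    ∃ m ∈ cycleMins π, x ∈ cycleList π m := by
  classical
  obtain ⟨m, hm, hmin⟩ := Finset.exists_min_image (Finset.univ.filter (fun y => ∃ k, (π ^ k) x = y))
    id ⟨x, by simp; exact ⟨0, by simp⟩⟩
  simp only [Finset.mem_filter, Finset.mem_univ, true_and, id] at hm hmin
  obtain ⟨k, hk⟩ := hm
  refine ⟨m, (mem_cycleMins π m).mpr ?_, (mem_cycleList π m x).mpr (exists_back π x m k hk)⟩
  intro j
  exact hmin _ ⟨j + k, by rw [pow_add, Equiv.Perm.mul_apply, hk]⟩

lemma cycles_disjoint (π : Equiv.Perm (Fin n)) (m m' x : Fin n) (hm : m ∈ cycleMins π)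
    (h : x ∈ cycleList π m') (h' : x ∈ cycleList π m) : m ≤ m' := by
  rw [mem_cycleList] at h h'
  rw [mem_cycleMins] at hm
  obtain ⟨i, hi⟩ := h
  obtain ⟨j, hj⟩ := h'
  obtain ⟨k, hk⟩ := exists_back π m' x i hi
  have := hm (k + j)
  rwa [pow_add, Equiv.Perm.mul_apply, hj, hk] at this

def mkW (L : List (Fin n × List (Fin n))) : List (ℕ × Bool) :=
  L.flatMap (fun p => ((p.1 : ℕ) + 1, true) :: p.2.map (fun x : Fin n => ((x : ℕ) + 1, false)))

noncomputable def mw (π : Equiv.Perm (Fin n)) : List (ℕ × Bool) :=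
  mkW ((cycleMins π).map (fun m => (m, cycTail π m)))

lemma flattenPerm_eq (π : Equiv.Perm (Fin n)) : flattenPerm π =
    ((cycleMins π).map (cycleList π)).flatten.map (fun m : Fin n => (m : ℕ) + 1) := by
  rw [flattenPerm]
  simp [List.map_eq_flatMap, List.flatMap_assoc]

lemma mw_fst (π : Equiv.Perm (Fin n)) : (mw π).map Prod.fst = flattenPerm π := by
  rw [mw, mkW, flattenPerm_eq]
  induction cycleMins π with
  | nil => simp
  | cons m L ih =>
    simp only [List.map_cons, List.flatMap_cons, List.map_append, ih, List.flatten_cons,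
      cycleList_eq π m]
    simp [Function.comp_def]

lemma flat_nodup (π : Equiv.Perm (Fin n)) : (flattenPerm π).Nodup := by
  rw [flattenPerm_eq]
  refine List.Nodup.map (fun a b h => Fin.ext (by simpa using h)) ?_
  rw [List.nodup_flatten]
  refine ⟨?_, ?_⟩
  · intro l hl
    obtain ⟨m, _, rfl⟩ := List.mem_map.mp hl
    exact cycleList_nodup π m
  · rw [List.pairwise_map]
    refine (cycleMins_sorted π).imp_of_mem ?_
    intro a b ha hb hab x hx hx'
    exact absurd (cycles_disjoint π b a x hb hx hx') (not_le.mpr hab)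

lemma mem_flat (π : Equiv.Perm (Fin n)) (x : ℕ) :
    x ∈ flattenPerm π ↔ x ∈ Finset.Icc 1 n := by
  simp only [flattenPerm_eq, List.mem_map, List.mem_flatten, Finset.mem_Icc]
  constructor
  · rintro ⟨y, -, rfl⟩; have := y.2; omega
  · rintro ⟨h1, h2⟩
    obtain ⟨m, hm, hx⟩ := exists_min π ⟨x - 1, by omega⟩
    exact ⟨_, ⟨_, ⟨m, hm, rfl⟩, hx⟩, by simp; omega⟩

lemma mw_pairwise (π : Equiv.Perm (Fin n)) :
    (mw π).Pairwise (fun p p' => p.2 = true → p.1 < p'.1) := by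
  rw [mw, mkW, List.pairwise_flatMap]
  refine ⟨?_, ?_⟩
  · intro p hp
    obtain ⟨m, hm, rfl⟩ := List.mem_map.mp hp
    rw [List.pairwise_cons]
    refine ⟨?_, ?_⟩
    · intro y hy _
      obtain ⟨x, hx, rfl⟩ := List.mem_map.mp hy
      have hx' : x ∈ cycleList π m := by rw [cycleList_eq]; exact List.mem_cons_of_mem _ hx
      have hnd := cycleList_nodup π m
      rw [cycleList_eq, List.nodup_cons] at hnd
      obtain ⟨k, hk⟩ := (mem_cycleList π m x).mp hx'
      have h1 : m ≤ x := hk ▸ (mem_cycleMins π m).mp hm k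
      have h2 : m ≠ x := fun h => hnd.1 (h ▸ hx)
      have := lt_of_le_of_ne h1 h2
      simpa using this
    · rw [List.pairwise_map]
      exact List.pairwise_of_forall (by simp)
  · rw [List.pairwise_map]
    refine (cycleMins_sorted π).imp_of_mem ?_
    intro a b ha hb hab x hx y hy hx2
    have hx1 : x.1 = (a : ℕ) + 1 := by
      rcases List.mem_cons.mp hx with h | h
      · rw [h]
      · obtain ⟨z, _, rfl⟩ := List.mem_map.mp h
        simp at hx2
    have hy1 : ∃ z ∈ cycleList π b, y.1 = (z : ℕ) + 1 := by
      rw [cycleList_eq]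
      rcases List.mem_cons.mp hy with h | h
      · exact ⟨b, by simp, by rw [h]⟩
      · obtain ⟨z, hz, rfl⟩ := List.mem_map.mp h
        exact ⟨z, List.mem_cons_of_mem _ hz, rfl⟩
    obtain ⟨z, hz, hyz⟩ := hy1
    obtain ⟨k, hk⟩ := (mem_cycleList π b z).mp hz
    have h1 : b ≤ z := hk ▸ (mem_cycleMins π b).mp hb k
    have h2 : a < z := lt_of_lt_of_le hab h1
    rw [hx1, hyz]
    have : (a : ℕ) < z := h2
    omega

lemma mkW_cases (L : List (Fin n × List (Fin n))) :
    mkW L = [] ∨ ∃ a l, mkW L = (a, true) :: l := by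
  cases L with
  | nil => left; rfl
  | cons p L => right; exact ⟨_, _, by rw [mkW, List.flatMap_cons, List.cons_append]⟩

lemma mkW_aux (A B : List (ℕ × Bool)) (hA : A = [] ∨ ∃ a l, A = (a, true) :: l)
    (hB : B = [] ∨ ∃ a l, B = (a, true) :: l) : ∀ t t' : List (Fin n),
    t.map (fun x : Fin n => ((x : ℕ) + 1, false)) ++ A = t'.map (fun x : Fin n => ((x : ℕ) + 1, false)) ++ B →
    t = t' ∧ A = B := by
  intro t
  induction t with
  | nil =>
    intro t' h
    cases t' with
    | nil => simpa using h
    | cons y t' => rcases hA with rfl | ⟨a, l, rfl⟩ <;> simp at h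
  | cons x t ih =>
    intro t' h
    cases t' with
    | nil => rcases hB with rfl | ⟨a, l, rfl⟩ <;> simp at h
    | cons y t' =>
      simp only [List.map_cons, List.cons_append, List.cons.injEq, Prod.mk.injEq, and_true] at h
      obtain ⟨h1, h2⟩ := ih t' h.2
      refine ⟨?_, h2⟩
      rw [h1, Fin.ext (by omega : (x : ℕ) = y)]

lemma mkW_inj : ∀ L L' : List (Fin n × List (Fin n)), mkW L = mkW L' → L = L' := by
  intro L
  induction L with
  | nil =>
    intro L' h
    cases L' with
    | nil => rfl
    | cons p L' => simp [mkW] at h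
  | cons p L ih =>
    intro L' h
    cases L' with
    | nil => simp [mkW] at h
    | cons p' L' =>
      have e : ∀ (p : Fin n × List (Fin n)) L, mkW (p :: L) = ((p.1 : ℕ) + 1, true) ::
          (p.2.map (fun x : Fin n => ((x : ℕ) + 1, false)) ++ mkW L) := fun p L => by
        rw [mkW, List.flatMap_cons, List.cons_append, ← mkW]
      rw [e, e, List.cons.injEq, Prod.mk.injEq] at h
      obtain ⟨h1, h2⟩ := mkW_aux _ _ (mkW_cases L) (mkW_cases L') _ _ h.2
      rw [ih L' h2]
      congr 1
      exact Prod.ext (Fin.ext (by omega)) h1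

lemma mw_inj : Function.Injective (mw (n := n)) := by
  intro π π' h
  have hL := mkW_inj _ _ h
  ext1 x
  obtain ⟨m, hm, hx⟩ := exists_min π x
  have h1 : (m, cycTail π m) ∈ (cycleMins π').map (fun m => (m, cycTail π' m)) :=
    hL ▸ List.mem_map.mpr ⟨m, hm, rfl⟩
  obtain ⟨m', _, h2⟩ := List.mem_map.mp h1
  rw [Prod.mk.injEq] at h2
  obtain ⟨rfl, h3⟩ := h2
  have hc : cycleList π m' = cycleList π' m' := by rw [cycleList_eq, cycleList_eq, h3]
  have hp : Function.minimalPeriod π m' = Function.minimalPeriod π' m' := by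
    have := congrArg List.length hc
    simpa [cycleList] using this
  have hk : ∀ k, (π ^ k) m' = (π' ^ k) m' := by
    intro k
    rw [← pow_mod π, ← pow_mod π', ← hp]
    have hlt := Nat.mod_lt k (minPer_pos π m')
    have := congrArg (fun l => l[k % Function.minimalPeriod π m']?) hc
    simpa [cycleList, ← hp, hlt] using this
  obtain ⟨k, rfl⟩ := (mem_cycleList π m' x).mp hx
  have := hk (k + 1)
  rw [pow_succ', pow_succ', Equiv.Perm.mul_apply, Equiv.Perm.mul_apply, ← hk k] at this
  rw [this]

lemma mw_mem (π : Equiv.Perm (Fin (n + 1))) :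
    ∃ l ∈ words n (Finset.Icc 2 (n + 1)), mw π = (1, true) :: l := by
  have hmem := mem_flat π
  have hnd := flat_nodup π
  have hpw := mw_pairwise π
  rw [← mw_fst] at hnd
  simp only [← mw_fst] at hmem
  rcases mkW_cases ((cycleMins π).map (fun m => (m, cycTail π m))) with h | ⟨a, l, h⟩
  · have := (hmem 1).mpr (by simp)
    rw [mw, h] at this
    simp at this
  · change mw π = _ at h
    rw [h] at hmem hnd hpw
    simp only [List.map_cons, List.nodup_cons] at hnd hmem
    rw [List.pairwise_cons] at hpw
    have ha : a = 1 := by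
      have h1 := (hmem a).mp (by simp)
      rw [Finset.mem_Icc] at h1
      have h2 := (hmem 1).mpr (by simp)
      rcases List.mem_cons.mp h2 with h2 | h2
      · exact h2.symm
      · obtain ⟨p, hp, hp1⟩ := List.mem_map.mp h2
        have := hpw.1 p hp rfl
        simp only at this
        omega
    subst ha
    have hmem' : ∀ x, x ∈ l.map Prod.fst ↔ x ∈ Finset.Icc 2 (n + 1) := by
      intro x
      have := hmem x
      rw [List.mem_cons, Finset.mem_Icc] at this
      rw [Finset.mem_Icc]
      constructor
      · intro hx
        have h1 : x ≠ 1 := fun e => hnd.1 (e ▸ hx)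
        have := this.mp (Or.inr hx)
        omega
      · intro hx
        rcases this.mpr (by omega) with h1 | h1
        · omega
        · exact h1
    refine ⟨l, mem_words n _ l ?_ hnd.2 hmem' hpw.2, h⟩
    have h1 : (l.map Prod.fst).toFinset = Finset.Icc 2 (n + 1) := by
      ext x; rw [List.mem_toFinset, hmem']
    have h2 := List.toFinset_card_of_nodup hnd.2
    rw [h1] at h2
    simpa using h2.symm

lemma image_mw : (Finset.univ : Finset (Equiv.Perm (Fin (n + 2)))).image mw =
    (words (n + 1) (Finset.Icc 2 (n + 2))).image (fun l => (1, true) :: l) := by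
  apply Finset.eq_of_subset_of_card_le
  · intro w hw
    obtain ⟨π, -, rfl⟩ := Finset.mem_image.mp hw
    obtain ⟨l, hl, h⟩ := mw_mem π
    exact Finset.mem_image.mpr ⟨l, hl, h.symm⟩
  · refine Finset.card_image_le.trans ?_
    rw [Finset.card_image_of_injective _ mw_inj, card_words n _ (by simp) (by simp)]
    simp [Fintype.card_perm]

lemma sum_perm {M : Type*} [AddCommMonoid M] (f : List ℕ → M) :
    ∑ π : Equiv.Perm (Fin (n + 2)), f (flattenPerm π) =
      ∑ l ∈ words (n + 1) (Finset.Icc 2 (n + 2)), f (1 :: l.map Prod.fst) := by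
  have h1 := Finset.sum_image (s := (Finset.univ : Finset (Equiv.Perm (Fin (n + 2))))) (g := mw)
    (f := fun l => f (l.map Prod.fst)) mw_inj.injOn
  have h2 := Finset.sum_image (s := words (n + 1) (Finset.Icc 2 (n + 2)))
    (g := fun l => (1, true) :: l)
    (f := fun l => f (l.map Prod.fst)) (fun a _ b _ h => by simpa using h)
  rw [image_mw, h2] at h1
  simp only [mw_fst] at h1
  exact h1.symm

end perms

/-! ### The algebraic part -/

noncomputable def BB (m r : ℕ) : Polynomial ℤ :=
  ∑ j ∈ Finset.range (m + 1), X ^ (j - r) * HH (X : Polynomial ℤ) m j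

lemma BB_sub (m r : ℕ) (hr : r ≤ m) :
    BB m r - X * BB m (r + 1) = (1 - X) * ∑ j ∈ Finset.range (r + 1), HH (X : Polynomial ℤ) m j := by
  obtain ⟨d, rfl⟩ := Nat.exists_eq_add_of_le hr
  have e : r + d + 1 = (r + 1) + d := by ring
  rw [BB, BB, e, Finset.sum_range_add _ (r + 1) d, Finset.sum_range_add _ (r + 1) d, mul_add, Finset.mul_sum,
    Finset.mul_sum, Finset.mul_sum]
  have h1 : ∑ x ∈ Finset.range d, X ^ (r + 1 + x - r) * HH (X : Polynomial ℤ) (r + d) (r + 1 + x)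
      = ∑ x ∈ Finset.range d,
        X * (X ^ (r + 1 + x - (r + 1)) * HH (X : Polynomial ℤ) (r + d) (r + 1 + x)) := by
    refine Finset.sum_congr rfl fun x _ => ?_
    have e1 : r + 1 + x - r = x + 1 := by omega
    have e2 : r + 1 + x - (r + 1) = x := by omega
    rw [e1, e2]; ring
  rw [h1, add_sub_add_right_eq_sub, ← Finset.sum_sub_distrib]
  refine Finset.sum_congr rfl fun j hj => ?_
  rw [Finset.mem_range] at hj
  have e1 : j - r = 0 := by omega
  have e2 : j - (r + 1) = 0 := by omega
  rw [e1, e2]; ring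

lemma BB_rec (m r : ℕ) (hr : r + 1 ≤ m) :
    X * BB m (r + 2) = (1 + X) * BB m (r + 1) - BB m r + (X - 1) * HH (X : Polynomial ℤ) m (r + 1) := by
  have h1 := BB_sub m r (by omega)
  have h2 := BB_sub m (r + 1) hr
  rw [Finset.sum_range_succ] at h2
  linear_combination h1 - h2

lemma HH_succ (m r : ℕ) : HH (X : Polynomial ℤ) (m + 1) (r + 1) = BB m (r + 1) := by
  simp [HH, BB]

lemma aP_zero (k : ℕ) : ∀ j : ℤ, j ≤ 0 → aP k j = 0 := by
  induction k using Nat.strong_induction_on with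
  | _ k ih =>
    intro j hj
    match k with
    | 0 => rw [aP]
    | 1 => rw [aP]
    | 2 => rw [aP, if_neg (by omega)]
    | 3 => rw [aP, if_neg (by omega), if_neg (by omega)]
    | k + 4 =>
      rw [aP, ih _ (by omega) _ hj, ih _ (by omega) _ hj, ih _ (by omega) _ (by omega)]; simp

lemma aP_large (k : ℕ) : ∀ j : ℤ, (k : ℤ) ≤ j → aP k j = 0 := by
  induction k using Nat.strong_induction_on with
  | _ k ih =>
    intro j hj
    match k with
    | 0 => rw [aP]
    | 1 => rw [aP]
    | 2 => rw [aP, if_neg (by push_cast at hj; omega)]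
    | 3 => rw [aP, if_neg (by push_cast at hj; omega), if_neg (by push_cast at hj; omega)]
    | k + 4 =>
      push_cast at hj
      rw [aP, ih _ (by omega) _ (by push_cast; omega), ih _ (by omega) _ (by push_cast; omega),
        ih _ (by omega) _ (by push_cast; omega)]; simp

noncomputable def TT (g : ℕ → Polynomial ℤ) (n k : ℕ) : Polynomial ℤ :=
  ∑ j ∈ Finset.range n, aP k ((j : ℤ) + 1) * (X - 1) ^ j * g (n - 1 - j)

lemma TT_eq (g : ℕ → Polynomial ℤ) (n k : ℕ) (h : k ≤ n) :
    TT g n k = ∑ j ∈ Finset.Icc 1 (k - 1), aP k (j : ℤ) * (X - 1) ^ (j - 1) * g (n - j) := by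
  rw [TT, ← Finset.sum_subset (Finset.range_subset_range.mpr (show k - 1 ≤ n by omega))]
  · rw [← Finset.Ico_add_one_right_eq_Icc, Finset.sum_Ico_eq_sum_range]
    refine Finset.sum_congr (by simp) fun j _ => ?_
    have e1 : 1 + j - 1 = j := by omega
    have e2 : n - (1 + j) = n - 1 - j := by omega
    rw [e1, e2]; push_cast; rw [add_comm (1 : ℤ)]
  · intro j _ hj
    rw [Finset.mem_range] at hj
    rw [aP_large _ _ (by omega)]; simp

lemma TT_rec (g : ℕ → Polynomial ℤ) (n k : ℕ) :
    TT g (n + 1) (k + 4) = (1 + X) * TT g (n + 1) (k + 3) - X * TT g (n + 1) (k + 2)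
      + (X - 1) * TT g n (k + 3) := by
  have h : (X - 1) * TT g n (k + 3) =
      ∑ j ∈ Finset.range (n + 1), aP (k + 3) (j : ℤ) * (X - 1) ^ j * g (n + 1 - 1 - j) := by
    rw [Finset.sum_range_succ', Nat.cast_zero, aP_zero _ 0 le_rfl, TT, Finset.mul_sum]
    simp only [zero_mul, add_zero]
    refine Finset.sum_congr rfl fun j _ => ?_
    have e : n + 1 - 1 - (j + 1) = n - 1 - j := by omega
    rw [e]; push_cast; ring
  rw [h]
  simp only [TT]
  rw [Finset.mul_sum, Finset.mul_sum, ← Finset.sum_sub_distrib, ← Finset.sum_add_distrib]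
  refine Finset.sum_congr rfl fun j _ => ?_
  rw [aP, add_sub_cancel_right]; ring

lemma main_alg (g : ℕ → Polynomial ℤ) (hg1 : g 1 = 1) (hg : ∀ m, g (m + 2) = BB m 0) :
    ∀ k n : ℕ, k ≤ n + 1 → X ^ k * BB n k = TT g (n + 3) (k + 2) := by
  have h2 : ∀ n, BB n 0 = TT g (n + 3) 2 := by
    intro n
    rw [TT_eq _ _ _ (by omega)]
    simp [aP, ← hg]
  have hH : ∀ n, HH (X : Polynomial ℤ) n 0 = 2 * g (n + 1) := by
    intro n
    cases n with
    | zero => simp [HH, hg1]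
    | succ n => rw [HH, hg, BB]; simp
  intro k
  induction k using Nat.strong_induction_on with
  | _ k ih =>
    intro n hk
    match k with
    | 0 => simpa using h2 n
    | 1 =>
      rw [TT_eq _ _ _ (by omega)]
      have h := BB_sub n 0 (by omega)
      rw [zero_add, Finset.sum_range_one, hH, ← hg] at h
      have e : Finset.Icc 1 (1 + 2 - 1) = {1, 2} := by decide
      rw [e, Finset.sum_pair (by norm_num)]
      have e1 : n + 3 - 1 = n + 2 := by omega
      have e2 : n + 3 - 2 = n + 1 := by omega
      simp only [aP, e1, e2]
      norm_num
      linear_combination -h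
    | k + 2 =>
      obtain ⟨n, rfl⟩ : ∃ n', n = n' + 1 := ⟨n - 1, by omega⟩
      rw [show n + 1 + 3 = (n + 3) + 1 by ring, show k + 2 + 2 = k + 4 by ring, TT_rec,
        ← ih (k + 1) (by omega) n (by omega)]
      have a1 := ih (k + 1) (by omega) (n + 1) (by omega)
      have a2 := ih k (by omega) (n + 1) (by omega)
      rw [show n + 1 + 3 = (n + 3) + 1 by ring] at a1 a2
      rw [← a1, ← a2]
      have h := BB_rec (n + 1) k (by omega)
      rw [HH_succ] at h
      linear_combination X ^ (k + 1) * h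

lemma gPoly_one : gPoly 1 = 1 := by
  have h : ∀ π : Equiv.Perm (Fin 1), occ (flattenPerm π) = 0 := by
    intro π
    obtain ⟨l, hl, h⟩ := mw_mem π
    have : l = [] := by simpa [words] using hl
    rw [← mw_fst, h, this, occ_eq_occL]
    simp [occL]
  simp [gPoly, h]

lemma rank_Icc (n k : ℕ) (hk : 2 ≤ k) (hkn : k ≤ n + 2) :
    rank (Finset.Icc 2 (n + 2)) k = k - 2 := by
  have : (Finset.Icc 2 (n + 2)).filter (· < k) = Finset.Ico 2 k := by
    ext x; simp; omega
  rw [rank, this]; simp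

lemma rank_Icc_one (n : ℕ) : rank (Finset.Icc 2 (n + 2)) 1 = 0 := by
  rw [rank, Finset.card_eq_zero, Finset.filter_eq_empty_iff]
  intro x hx; rw [Finset.mem_Icc] at hx; omega

lemma gPoly_add_two (n : ℕ) : gPoly (n + 2) = BB n 0 := by
  rw [gPoly, sum_perm (fun w => (X : Polynomial ℤ) ^ occ w)]
  have := sum_words_cons (X : Polynomial ℤ) n (Finset.Icc 2 (n + 2)) (by simp) 1 true (by simp)
  rw [rank_Icc_one] at this
  rw [BB, ← this]
  refine Finset.sum_congr rfl fun l _ => ?_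
  rw [wt, occ_eq_occL, List.map_cons]

lemma gPrefix_eq (n k : ℕ) (hk : 2 ≤ k) (hkn : k ≤ n + 2) :
    gPrefix (n + 2) [1, k] = X ^ (k - 2) * HH (X : Polynomial ℤ) n (k - 2) := by
  have hkS : k ∈ Finset.Icc 2 (n + 2) := by simp; omega
  have hc : (Finset.Icc 2 (n + 2)).card = n + 1 := by simp
  rw [gPrefix, Finset.sum_filter,
    sum_perm (fun w => if [1, k] <+: w then (X : Polynomial ℤ) ^ occ w else 0), sum_words_succ,
    Finset.sum_eq_single k]
  · have h := sum_wordsFrom_cons (X : Polynomial ℤ) n _ hc 1 k true hkS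
    rw [sum_wordsFrom_eq _ n _ hc k hkS, card_between _ _ _ (by simp), rank_Icc_one,
      rank_Icc n k hk hkn, Nat.sub_zero] at h
    rw [← h]
    refine Finset.sum_congr rfl fun l hl => ?_
    obtain ⟨b, l', -, -, rfl⟩ := mem_wordsFrom.mp hl
    rw [wt, occ_eq_occL, List.map_cons, List.map_cons, if_pos (by simp)]
    rfl
  · intro c _ hck
    refine Finset.sum_eq_zero fun l hl => ?_
    obtain ⟨b, l', -, -, rfl⟩ := mem_wordsFrom.mp hl
    rw [if_neg]
    rintro ⟨t, ht⟩
    simp at ht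
    exact hck ht.1.symm
  · intro h; exact absurd hkS h

/-- For `n ≥ 3` and `3 ≤ k ≤ n`,
`g_n(1k) = Σ_{j=1}^{k-1} a_{k,j}·(q−1)^{j-1}·g_{n-j}` in `ℤ[q]`. -/
theorem gPrefix_eq_sum_aP (n k : ℕ) (hn : 3 ≤ n) (hk : 3 ≤ k) (hkn : k ≤ n) :
    gPrefix n [1, k] = ∑ j ∈ Finset.Icc 1 (k - 1), aP k (j : ℤ) * (X - 1) ^ (j - 1) * gPoly (n - j) := by
  obtain ⟨m, rfl⟩ : ∃ m, n = m + 3 := ⟨n - 3, by omega⟩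
  obtain ⟨r, rfl⟩ : ∃ r, k = r + 3 := ⟨k - 3, by omega⟩
  rw [← TT_eq gPoly _ _ hkn, ← main_alg gPoly gPoly_one gPoly_add_two (r + 1) m (by omega),
    gPrefix_eq (m + 1) (r + 3) (by omega) (by omega), ← HH_succ]
  rfl
end
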